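/- For every λ ∈ 𝔫* and every integer e ≥ 0: every irreducible constituent of χ_λ of degree q^e is a Kirillov function of G if and only if every irreducible character ψ of the algebra group S_λ/K_λ satisfying ψ(π(z)) = (|Gλ ∩ λG|/|Gλ|)·q^e·θ_λ(z) for all z ∈ L_λ is a Kirillov function of S_λ/K_λ. -/

import Mathlib

open scoped Classical BigOperators ComplexOrder

set_option linter.unusedSectionVars false
set_option linter.unusedVariables false

noncomputable section

namespace IterChar

/-! ### Generic notions for finite groups: inner product, induction, characters -/

/-- The standard inner product `⟨f,h⟩_G = |G|⁻¹ ∑_{x ∈ G} f x * conj (h x)`. -/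
def innerG (G : Type) [Group G] (f h : G → ℂ) : ℂ :=
  (Nat.card G : ℂ)⁻¹ * ∑ᶠ x : G, f x * (starRingEnd ℂ) (h x)

/-- Induction of a function from a subgroup, via the Frobenius formula. -/
def indFun {G : Type} [Group G] (H : Subgroup G) (ψ : ↥H → ℂ) : G → ℂ :=
  fun g => (Nat.card ↥H : ℂ)⁻¹ *
    ∑ᶠ x : G, if h : x * g * x⁻¹ ∈ H then ψ ⟨x * g * x⁻¹, h⟩ else 0

/-- A function `G → ℂ` is a character if it is the trace character of some
finite-dimensional complex representation. -/
def IsCharacter (G : Type) [Group G] (f : G → ℂ) : Prop :=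
  ∃ V : FDRep ℂ G, f = FDRep.character V

/-- The set of irreducible characters of `G`: characters of norm one. -/
def Irr (G : Type) [Group G] : Set (G → ℂ) :=
  {f | IsCharacter G f ∧ innerG G f f = 1}

/-- The set of irreducible constituents of `χ`: irreducible characters with
`⟨χ, ψ⟩_G > 0` (using the complex partial order). -/
def IrrConstituents (G : Type) [Group G] (χ : G → ℂ) : Set (G → ℂ) :=
  {f | f ∈ Irr G ∧ 0 < innerG G χ f}

/-! ### Algebra groups -/

variable {F : Type} [Field F] [Fintype F] {R : Type} [Ring R] [Algebra F R] [Fintype R]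

/-- `J` is a nilpotent (non-unital) subalgebra: all products of some fixed length vanish. -/
def IsNil (J : NonUnitalSubalgebra F R) : Prop :=
  ∃ N : ℕ, ∀ l : List R, (∀ x ∈ l, x ∈ J) → l.length = N → l.prod = 0

/-- The algebra group `G = 1 + J` of a (nilpotent) subalgebra `J ⊆ R`, realized as the
subgroup of units `u` of `R` with `u - 1 ∈ J` (and `u⁻¹ - 1 ∈ J`, which is automatic
when `J` is nilpotent). -/
def algGroup (F : Type) [Field F] [Fintype F] (R : Type) [Ring R] [Algebra F R] [Fintype R]
    (J : NonUnitalSubalgebra F R) : Subgroup Rˣ where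
  carrier := {u : Rˣ | ((u : R) - 1 ∈ J) ∧ (((u⁻¹ : Rˣ) : R) - 1 ∈ J)}
  one_mem' := by
    constructor <;> · simp only [Units.val_one, inv_one, sub_self]; exact J.zero_mem
  mul_mem' := by
    rintro u v ⟨hu1, hu2⟩ ⟨hv1, hv2⟩
    constructor
    · have h : ((u * v : Rˣ) : R) - 1 =
          ((u : R) - 1) * ((v : R) - 1) + ((u : R) - 1) + ((v : R) - 1) := by
        push_cast; noncomm_ring
      rw [h]
      exact add_mem (add_mem (mul_mem hu1 hv1) hu1) hv1
    · have h : (((u * v)⁻¹ : Rˣ) : R) - 1 =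
          (((v⁻¹ : Rˣ) : R) - 1) * (((u⁻¹ : Rˣ) : R) - 1) +
            (((v⁻¹ : Rˣ) : R) - 1) + (((u⁻¹ : Rˣ) : R) - 1) := by
        rw [mul_inv_rev]; push_cast; noncomm_ring
      rw [h]
      exact add_mem (add_mem (mul_mem hv2 hu2) hv2) hu2
  inv_mem' := by
    rintro u ⟨h1, h2⟩
    exact ⟨h2, by simpa using h1⟩

theorem mem_algGroup {J : NonUnitalSubalgebra F R} {u : Rˣ} :
    u ∈ algGroup F R J ↔ ((u : R) - 1 ∈ J) ∧ (((u⁻¹ : Rˣ) : R) - 1 ∈ J) :=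
  Iff.rfl

/-- The element `X ∈ J` such that `g = 1 + X`. -/
def gElt {J : NonUnitalSubalgebra F R} (g : ↥(algGroup F R J)) : ↥J :=
  ⟨((g : Rˣ) : R) - 1, g.2.1⟩

/-- The function `θ_λ(1+X) = θ(λ(X))` on the algebra group `1 + J`. -/
def thetaFn (θ : AddChar F ℂ) (J : NonUnitalSubalgebra F R) (lam : ↥J →ₗ[F] F) :
    ↥(algGroup F R J) → ℂ :=
  fun g => θ (lam (gElt g))

/-- Left multiplication by the group element `g` as a linear endomorphism of `J`. -/
def lmulMap {J : NonUnitalSubalgebra F R} (g : ↥(algGroup F R J)) : ↥J →ₗ[F] ↥J where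
  toFun X := ⟨((g : Rˣ) : R) * (X : R), by
    have h : ((g : Rˣ) : R) * (X : R) = (((g : Rˣ) : R) - 1) * (X : R) + (X : R) := by
      noncomm_ring
    rw [h]; exact add_mem (mul_mem g.2.1 X.2) X.2⟩
  map_add' X Y := by ext; simp [mul_add]
  map_smul' c X := by ext; simp [mul_smul_comm]

/-- Right multiplication by the group element `g` as a linear endomorphism of `J`. -/
def rmulMap {J : NonUnitalSubalgebra F R} (g : ↥(algGroup F R J)) : ↥J →ₗ[F] ↥J where
  toFun X := ⟨(X : R) * ((g : Rˣ) : R), by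
    have h : (X : R) * ((g : Rˣ) : R) = (X : R) * (((g : Rˣ) : R) - 1) + (X : R) := by
      noncomm_ring
    rw [h]; exact add_mem (mul_mem X.2 g.2.1) X.2⟩
  map_add' X Y := by ext; simp [add_mul]
  map_smul' c X := by ext; simp [smul_mul_assoc]

/-- The left action of `G` on the dual space: `(gλ)(X) = λ(g⁻¹ X)`. -/
def leftAct {J : NonUnitalSubalgebra F R} (g : ↥(algGroup F R J)) (lam : ↥J →ₗ[F] F) :
    ↥J →ₗ[F] F :=
  lam.comp (lmulMap g⁻¹)

/-- The right action of `G` on the dual space: `(λg)(X) = λ(X g⁻¹)`. -/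
def rightAct {J : NonUnitalSubalgebra F R} (g : ↥(algGroup F R J)) (lam : ↥J →ₗ[F] F) :
    ↥J →ₗ[F] F :=
  lam.comp (rmulMap g⁻¹)

/-- The coadjoint action of `G` on the dual space: `λ^g(X) = λ(g X g⁻¹)`. -/
def coAct {J : NonUnitalSubalgebra F R} (g : ↥(algGroup F R J)) (lam : ↥J →ₗ[F] F) :
    ↥J →ₗ[F] F :=
  lam.comp ((lmulMap g).comp (rmulMap g⁻¹))

/-- The left orbit `Gλ`. -/
def leftOrbit (J : NonUnitalSubalgebra F R) (lam : ↥J →ₗ[F] F) : Set (↥J →ₗ[F] F) :=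
  Set.range fun g : ↥(algGroup F R J) => leftAct g lam

/-- The right orbit `λG`. -/
def rightOrbit (J : NonUnitalSubalgebra F R) (lam : ↥J →ₗ[F] F) : Set (↥J →ₗ[F] F) :=
  Set.range fun g : ↥(algGroup F R J) => rightAct g lam

/-- The two-sided orbit `GλG`. -/
def twoOrbit (J : NonUnitalSubalgebra F R) (lam : ↥J →ₗ[F] F) : Set (↥J →ₗ[F] F) :=
  {mu | ∃ g h : ↥(algGroup F R J), mu = leftAct g (rightAct h lam)}

/-- The coadjoint orbit `λ^G`. -/
def coOrbit (J : NonUnitalSubalgebra F R) (lam : ↥J →ₗ[F] F) : Set (↥J →ₗ[F] F) :=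
  Set.range fun g : ↥(algGroup F R J) => coAct g lam

/-- The right orbit of `λ` under a subgroup `H` of the algebra group. -/
def rightOrbitUnder (J : NonUnitalSubalgebra F R) (H : Subgroup ↥(algGroup F R J))
    (lam : ↥J →ₗ[F] F) : Set (↥J →ₗ[F] F) :=
  {mu | ∃ s ∈ H, mu = rightAct s lam}

/-- The Kirillov function `ψ_λ = |λ^G|^{-1/2} ∑_{μ ∈ λ^G} θ_μ`. -/
def kirillov (θ : AddChar F ℂ) (J : NonUnitalSubalgebra F R) (lam : ↥J →ₗ[F] F) :
    ↥(algGroup F R J) → ℂ :=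
  fun g => ((Real.sqrt (Nat.card ↥(coOrbit J lam)) : ℂ))⁻¹ *
    ∑ᶠ mu ∈ coOrbit J lam, thetaFn θ J mu g

/-- The supercharacter `χ_λ = (|Gλ|/|GλG|) ∑_{μ ∈ GλG} θ_μ`. -/
def superchar (θ : AddChar F ℂ) (J : NonUnitalSubalgebra F R) (lam : ↥J →ₗ[F] F) :
    ↥(algGroup F R J) → ℂ :=
  fun g => ((Nat.card ↥(leftOrbit J lam) : ℂ) / (Nat.card ↥(twoOrbit J lam) : ℂ)) *
    ∑ᶠ mu ∈ twoOrbit J lam, thetaFn θ J mu g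

/-! ### The subalgebras `𝔩_λ`, `𝔰_λ` and their iterates -/

/-- The extension of `λ : J → F` by zero to all of `R`. -/
def lamE (J : NonUnitalSubalgebra F R) (lam : ↥J →ₗ[F] F) (x : R) : F :=
  if h : x ∈ J then lam ⟨x, h⟩ else 0

theorem lamE_apply (J : NonUnitalSubalgebra F R) (lam : ↥J →ₗ[F] F) {x : R} (hx : x ∈ J) :
    lamE J lam x = lam ⟨x, hx⟩ := dif_pos hx

theorem lamE_zero (J : NonUnitalSubalgebra F R) (lam : ↥J →ₗ[F] F) : lamE J lam 0 = 0 := by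
  rw [lamE_apply J lam J.zero_mem]
  have h : (⟨(0 : R), J.zero_mem⟩ : ↥J) = 0 := Subtype.ext rfl
  rw [h, map_zero]

theorem lamE_add (J : NonUnitalSubalgebra F R) (lam : ↥J →ₗ[F] F) {x y : R}
    (hx : x ∈ J) (hy : y ∈ J) : lamE J lam (x + y) = lamE J lam x + lamE J lam y := by
  rw [lamE, lamE, lamE, dif_pos (add_mem hx hy), dif_pos hx, dif_pos hy]
  have h : (⟨x + y, add_mem hx hy⟩ : ↥J) = ⟨x, hx⟩ + ⟨y, hy⟩ := Subtype.ext rfl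
  rw [h, map_add]

theorem lamE_smul (J : NonUnitalSubalgebra F R) (lam : ↥J →ₗ[F] F) (c : F) {x : R}
    (hx : x ∈ J) : lamE J lam (c • x) = c * lamE J lam x := by
  rw [lamE, lamE, dif_pos (SMulMemClass.smul_mem c hx), dif_pos hx]
  have h : (⟨c • x, SMulMemClass.smul_mem c hx⟩ : ↥J) = c • ⟨x, hx⟩ := Subtype.ext rfl
  rw [h, map_smul]
  rfl

/-- The left kernel `𝔩` of the bilinear form `(X,Y) ↦ λ(XY)` restricted to `s × s`. -/
def lStep (J : NonUnitalSubalgebra F R) (lam : ↥J →ₗ[F] F)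
    (s : NonUnitalSubalgebra F R) (hs : s ≤ J) : NonUnitalSubalgebra F R where
  carrier := {x | x ∈ s ∧ ∀ y ∈ s, lamE J lam (x * y) = 0}
  zero_mem' := ⟨zero_mem s, fun y _ => by rw [zero_mul, lamE_zero]⟩
  add_mem' := by
    rintro a b ⟨ha1, ha2⟩ ⟨hb1, hb2⟩
    refine ⟨add_mem ha1 hb1, fun y hy => ?_⟩
    rw [add_mul, lamE_add J lam (J.mul_mem (hs ha1) (hs hy)) (J.mul_mem (hs hb1) (hs hy)),
      ha2 y hy, hb2 y hy, add_zero]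
  smul_mem' := by
    rintro c a ⟨ha1, ha2⟩
    refine ⟨SMulMemClass.smul_mem c ha1, fun y hy => ?_⟩
    rw [smul_mul_assoc, lamE_smul J lam c (J.mul_mem (hs ha1) (hs hy)), ha2 y hy, mul_zero]
  mul_mem' := by
    rintro a b ⟨ha1, ha2⟩ ⟨hb1, hb2⟩
    refine ⟨mul_mem ha1 hb1, fun y hy => ?_⟩
    rw [mul_assoc]
    exact ha2 (b * y) (mul_mem hb1 hy)

theorem lStep_le (J : NonUnitalSubalgebra F R) (lam : ↥J →ₗ[F] F)
    (s : NonUnitalSubalgebra F R) (hs : s ≤ J) : lStep J lam s hs ≤ s :=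
  fun _ hx => hx.1

/-- The left kernel `𝔰` of the bilinear form `(X,Y) ↦ λ(XY)` restricted to `s × 𝔩`. -/
def sStep (J : NonUnitalSubalgebra F R) (lam : ↥J →ₗ[F] F)
    (s : NonUnitalSubalgebra F R) (hs : s ≤ J) : NonUnitalSubalgebra F R where
  carrier := {x | x ∈ s ∧ ∀ y ∈ lStep J lam s hs, lamE J lam (x * y) = 0}
  zero_mem' := ⟨zero_mem s, fun y _ => by rw [zero_mul, lamE_zero]⟩
  add_mem' := by
    rintro a b ⟨ha1, ha2⟩ ⟨hb1, hb2⟩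
    refine ⟨add_mem ha1 hb1, fun y hy => ?_⟩
    rw [add_mul, lamE_add J lam (J.mul_mem (hs ha1) (hs hy.1)) (J.mul_mem (hs hb1) (hs hy.1)),
      ha2 y hy, hb2 y hy, add_zero]
  smul_mem' := by
    rintro c a ⟨ha1, ha2⟩
    refine ⟨SMulMemClass.smul_mem c ha1, fun y hy => ?_⟩
    rw [smul_mul_assoc, lamE_smul J lam c (J.mul_mem (hs ha1) (hs hy.1)), ha2 y hy, mul_zero]
  mul_mem' := by
    rintro a b ⟨ha1, ha2⟩ ⟨hb1, hb2⟩
    refine ⟨mul_mem ha1 hb1, fun y hy => ?_⟩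
    rw [mul_assoc]
    refine ha2 (b * y) ⟨mul_mem hb1 hy.1, fun z hz => ?_⟩
    rw [mul_assoc]
    refine hb2 (y * z) ⟨mul_mem hy.1 hz, fun w hw => ?_⟩
    rw [mul_assoc]
    exact hy.2 (z * w) (mul_mem hz hw)

theorem sStep_le (J : NonUnitalSubalgebra F R) (lam : ↥J →ₗ[F] F)
    (s : NonUnitalSubalgebra F R) (hs : s ≤ J) : sStep J lam s hs ≤ s :=
  fun _ hx => hx.1

/-- `𝔩_λ`: the left kernel of `(X,Y) ↦ λ(XY)` on `J × J`. -/
def lone (J : NonUnitalSubalgebra F R) (lam : ↥J →ₗ[F] F) : NonUnitalSubalgebra F R :=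
  lStep J lam J le_rfl

/-- `𝔰_λ`: the left kernel of `(X,Y) ↦ λ(XY)` on `J × 𝔩_λ`. -/
def sone (J : NonUnitalSubalgebra F R) (lam : ↥J →ₗ[F] F) : NonUnitalSubalgebra F R :=
  sStep J lam J le_rfl

theorem lone_le (J : NonUnitalSubalgebra F R) (lam : ↥J →ₗ[F] F) : lone J lam ≤ J :=
  lStep_le J lam J le_rfl

theorem sone_le (J : NonUnitalSubalgebra F R) (lam : ↥J →ₗ[F] F) : sone J lam ≤ J :=
  sStep_le J lam J le_rfl

/-- `𝔨_λ = 𝔩_λ ∩ ker λ`. -/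
def kone (J : NonUnitalSubalgebra F R) (lam : ↥J →ₗ[F] F) : NonUnitalSubalgebra F R where
  carrier := {x | x ∈ lone J lam ∧ lamE J lam x = 0}
  zero_mem' := ⟨zero_mem _, lamE_zero J lam⟩
  add_mem' := by
    rintro a b ⟨ha1, ha2⟩ ⟨hb1, hb2⟩
    exact ⟨add_mem ha1 hb1, by
      rw [lamE_add J lam (lone_le J lam ha1) (lone_le J lam hb1), ha2, hb2, add_zero]⟩
  smul_mem' := by
    rintro c a ⟨ha1, ha2⟩
    exact ⟨SMulMemClass.smul_mem c ha1, by
      rw [lamE_smul J lam c (lone_le J lam ha1), ha2, mul_zero]⟩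
  mul_mem' := by
    rintro a b ⟨ha1, ha2⟩ ⟨hb1, hb2⟩
    exact ⟨mul_mem ha1 hb1, ha1.2 b (lone_le J lam hb1)⟩

theorem kone_le (J : NonUnitalSubalgebra F R) (lam : ↥J →ₗ[F] F) : kone J lam ≤ lone J lam :=
  fun _ hx => hx.1

/-- The descending chain `𝔰_λ^0 ⊇ 𝔰_λ^1 ⊇ ⋯` (bundled with the proof `𝔰_λ^i ≤ J`). -/
def sChainAux (J : NonUnitalSubalgebra F R) (lam : ↥J →ₗ[F] F) :
    ℕ → {s : NonUnitalSubalgebra F R // s ≤ J}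
  | 0 => ⟨J, le_rfl⟩
  | n + 1 =>
    ⟨sStep J lam (sChainAux J lam n).1 (sChainAux J lam n).2,
      le_trans (sStep_le J lam (sChainAux J lam n).1 (sChainAux J lam n).2)
        (sChainAux J lam n).2⟩

/-- `𝔰_λ^i`. -/
def sChain (J : NonUnitalSubalgebra F R) (lam : ↥J →ₗ[F] F) (i : ℕ) :
    NonUnitalSubalgebra F R :=
  (sChainAux J lam i).1

/-- `𝔩_λ^{i+1}`. -/
def lChain (J : NonUnitalSubalgebra F R) (lam : ↥J →ₗ[F] F) (i : ℕ) :
    NonUnitalSubalgebra F R :=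
  lStep J lam (sChainAux J lam i).1 (sChainAux J lam i).2

/-- The terminal element `𝔰̄_λ` of the descending chain; the chain has stabilized by
stage `|R|` since it is a weakly decreasing chain of subalgebras of the finite algebra. -/
def sbar (J : NonUnitalSubalgebra F R) (lam : ↥J →ₗ[F] F) : NonUnitalSubalgebra F R :=
  sChain J lam (Fintype.card R)

theorem sbar_le (J : NonUnitalSubalgebra F R) (lam : ↥J →ₗ[F] F) : sbar J lam ≤ J :=
  (sChainAux J lam (Fintype.card R)).2

/-- The terminal element `𝔩̄_λ` of the ascending chain. -/
def lbar (J : NonUnitalSubalgebra F R) (lam : ↥J →ₗ[F] F) : NonUnitalSubalgebra F R :=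
  lStep J lam (sbar J lam) (sbar_le J lam)

theorem lbar_le (J : NonUnitalSubalgebra F R) (lam : ↥J →ₗ[F] F) : lbar J lam ≤ J :=
  le_trans (lStep_le J lam _ _) (sbar_le J lam)

/-! ### Algebra subgroups of an algebra group -/

/-- The algebra subgroup `1 + k` of `1 + J`, as a subgroup of the ambient algebra group. -/
def algSubgroup (k J : NonUnitalSubalgebra F R) : Subgroup ↥(algGroup F R J) :=
  (algGroup F R k).subgroupOf (algGroup F R J)

/-- `L_λ = 1 + 𝔩_λ` as a subgroup of `G`. -/
def Lgrp (J : NonUnitalSubalgebra F R) (lam : ↥J →ₗ[F] F) : Subgroup ↥(algGroup F R J) :=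
  algSubgroup (lone J lam) J

/-- `S_λ = 1 + 𝔰_λ` as a subgroup of `G`. -/
def Sgrp (J : NonUnitalSubalgebra F R) (lam : ↥J →ₗ[F] F) : Subgroup ↥(algGroup F R J) :=
  algSubgroup (sone J lam) J

/-- `L̄_λ = 1 + 𝔩̄_λ` as a subgroup of `G`. -/
def Lbarg (J : NonUnitalSubalgebra F R) (lam : ↥J →ₗ[F] F) : Subgroup ↥(algGroup F R J) :=
  algSubgroup (lbar J lam) J

/-- `S̄_λ = 1 + 𝔰̄_λ` as a subgroup of `G`. -/
def Sbarg (J : NonUnitalSubalgebra F R) (lam : ↥J →ₗ[F] F) : Subgroup ↥(algGroup F R J) :=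
  algSubgroup (sbar J lam) J

/-- Passing from an element of the subgroup `1 + k ≤ 1 + J` to an element of the
algebra group `1 + k` in its own right. -/
def toAlg {k J : NonUnitalSubalgebra F R} (x : ↥(algSubgroup k J)) : ↥(algGroup F R k) :=
  ⟨((x : ↥(algGroup F R J)) : Rˣ), Subgroup.mem_subgroupOf.mp x.2⟩

/-- The linear inclusion of a smaller subalgebra. -/
def inclMap {s J : NonUnitalSubalgebra F R} (h : s ≤ J) : ↥s →ₗ[F] ↥J where
  toFun x := ⟨(x : R), h x.2⟩
  map_add' x y := rfl
  map_smul' c x := rfl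

/-- Restriction of a functional on `J` to a smaller subalgebra. -/
def resTo {s J : NonUnitalSubalgebra F R} (h : s ≤ J) (lam : ↥J →ₗ[F] F) : ↥s →ₗ[F] F :=
  lam.comp (inclMap h)

/-- The character `ξ_λ = Ind_{L̄_λ}^G (θ_λ)`. -/
def xi (θ : AddChar F ℂ) (J : NonUnitalSubalgebra F R) (lam : ↥J →ₗ[F] F) :
    ↥(algGroup F R J) → ℂ :=
  indFun (Lbarg J lam) (fun x => thetaFn θ J lam ↑x)

/-- The set `Ξ_λ = {g λ s g⁻¹ : g ∈ G, s ∈ S̄_λ}`. -/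
def Xi (J : NonUnitalSubalgebra F R) (lam : ↥J →ₗ[F] F) : Set (↥J →ₗ[F] F) :=
  {nu | ∃ g : ↥(algGroup F R J), ∃ s ∈ Sbarg J lam, nu = coAct g (rightAct s lam)}

/-! ### Normality of algebra subgroups coming from ideals -/

theorem conj_mem_aux (s a : NonUnitalSubalgebra F R)
    (hl : ∀ x ∈ s, ∀ y ∈ a, x * y ∈ a) (hr : ∀ y ∈ a, ∀ x ∈ s, y * x ∈ a)
    (u : Rˣ) (hu1 : (u : R) - 1 ∈ s) (hu2 : ((u⁻¹ : Rˣ) : R) - 1 ∈ s)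
    (x : Rˣ) (hx : (x : R) - 1 ∈ a) : ((u * x * u⁻¹ : Rˣ) : R) - 1 ∈ a := by
  have h1 : (u : R) * ((u⁻¹ : Rˣ) : R) = 1 := Units.mul_inv u
  have key : ((u * x * u⁻¹ : Rˣ) : R) - 1 =
      ((u : R) - 1) * ((x : R) - 1) * (((u⁻¹ : Rˣ) : R) - 1) +
        ((u : R) - 1) * ((x : R) - 1) + ((x : R) - 1) * (((u⁻¹ : Rˣ) : R) - 1) +
        ((x : R) - 1) := by
    push_cast
    calc (u : R) * (x : R) * ((u⁻¹ : Rˣ) : R) - 1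
        = (u : R) * (x : R) * ((u⁻¹ : Rˣ) : R) - (u : R) * ((u⁻¹ : Rˣ) : R) := by rw [h1]
      _ = _ := by noncomm_ring
  rw [key]
  exact add_mem (add_mem (add_mem (hr _ (hl _ hu1 _ hx) _ hu2) (hl _ hu1 _ hx))
    (hr _ hx _ hu2)) hx

theorem algSubgroup_normal (s a : NonUnitalSubalgebra F R)
    (hl : ∀ x ∈ s, ∀ y ∈ a, x * y ∈ a) (hr : ∀ y ∈ a, ∀ x ∈ s, y * x ∈ a) :
    ((algGroup F R a).subgroupOf (algGroup F R s)).Normal := by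
  constructor
  intro n hn g
  rw [Subgroup.mem_subgroupOf] at hn ⊢
  have hginv : ((g⁻¹ : ↥(algGroup F R s)) : Rˣ) = ((g : Rˣ))⁻¹ := rfl
  have hcoe : ((g * n * g⁻¹ : ↥(algGroup F R s)) : Rˣ) = (g : Rˣ) * (n : Rˣ) * ((g : Rˣ))⁻¹ := by
    push_cast [hginv]; rfl
  rw [mem_algGroup]
  constructor
  · rw [hcoe]
    exact conj_mem_aux s a hl hr (g : Rˣ) (g : ↥(algGroup F R s)).2.1 (g : ↥(algGroup F R s)).2.2
      (n : Rˣ) hn.1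
  · have hinv : (((g * n * g⁻¹ : ↥(algGroup F R s)) : Rˣ))⁻¹ =
        (g : Rˣ) * ((n : Rˣ))⁻¹ * ((g : Rˣ))⁻¹ := by
      rw [hcoe]; group
    rw [hinv]
    exact conj_mem_aux s a hl hr (g : Rˣ) (g : ↥(algGroup F R s)).2.1 (g : ↥(algGroup F R s)).2.2
      ((n : Rˣ))⁻¹ hn.2

theorem lone_mul_mem (J : NonUnitalSubalgebra F R) (lam : ↥J →ₗ[F] F)
    {y z : R} (hy : y ∈ lone J lam) (hz : z ∈ J) : y * z ∈ lone J lam := by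
  refine ⟨J.mul_mem (lone_le J lam hy) hz, fun w hw => ?_⟩
  rw [mul_assoc]
  exact hy.2 (z * w) (J.mul_mem hz hw)

theorem sone_mul_lone_mem (J : NonUnitalSubalgebra F R) (lam : ↥J →ₗ[F] F)
    {x y : R} (hx : x ∈ sone J lam) (hy : y ∈ lone J lam) : x * y ∈ lone J lam := by
  refine ⟨J.mul_mem (sone_le J lam hx) (lone_le J lam hy), fun w hw => ?_⟩
  rw [mul_assoc]
  exact hx.2 (y * w) (lone_mul_mem J lam hy hw)

theorem kone_ideal_left (J : NonUnitalSubalgebra F R) (lam : ↥J →ₗ[F] F) :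
    ∀ x ∈ sone J lam, ∀ y ∈ kone J lam, x * y ∈ kone J lam := by
  intro x hx y hy
  exact ⟨sone_mul_lone_mem J lam hx hy.1, hx.2 y hy.1⟩

theorem kone_ideal_right (J : NonUnitalSubalgebra F R) (lam : ↥J →ₗ[F] F) :
    ∀ y ∈ kone J lam, ∀ x ∈ sone J lam, y * x ∈ kone J lam := by
  intro y hy x hx
  exact ⟨lone_mul_mem J lam hy.1 (sone_le J lam hx), hy.1.2 x (sone_le J lam hx)⟩

/-- `K_λ = 1 + 𝔨_λ` as a (normal) subgroup of `S_λ = 1 + 𝔰_λ`. -/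
def KgrpIn (J : NonUnitalSubalgebra F R) (lam : ↥J →ₗ[F] F) :
    Subgroup ↥(algGroup F R (sone J lam)) :=
  (algGroup F R (kone J lam)).subgroupOf (algGroup F R (sone J lam))

instance KgrpIn_normal (J : NonUnitalSubalgebra F R) (lam : ↥J →ₗ[F] F) :
    (KgrpIn J lam).Normal :=
  algSubgroup_normal (sone J lam) (kone J lam) (kone_ideal_left J lam) (kone_ideal_right J lam)

/-- `L_λ = 1 + 𝔩_λ` as a (normal) subgroup of `S_λ = 1 + 𝔰_λ`. -/
def LgrpIn (J : NonUnitalSubalgebra F R) (lam : ↥J →ₗ[F] F) :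
    Subgroup ↥(algGroup F R (sone J lam)) :=
  (algGroup F R (lone J lam)).subgroupOf (algGroup F R (sone J lam))

instance LgrpIn_normal (J : NonUnitalSubalgebra F R) (lam : ↥J →ₗ[F] F) :
    (LgrpIn J lam).Normal :=
  algSubgroup_normal (sone J lam) (lone J lam)
    (fun x hx y hy => sone_mul_lone_mem J lam hx hy)
    (fun y hy x hx => lone_mul_mem J lam hy (sone_le J lam hx))

/-! ### Class functions, induction along a homomorphism, and inner products -/

section FiniteGroups

variable {G S : Type} [Group G] [Fintype G] [Group S] [Fintype S]

theorem innerG_eq_sum (f h : G → ℂ) :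
    innerG G f h = (Nat.card G : ℂ)⁻¹ * ∑ x : G, f x * (starRingEnd ℂ) (h x) := by
  rw [innerG, finsum_eq_sum_of_fintype]

theorem card_ne_zero' : (Nat.card G : ℂ) ≠ 0 := by
  exact_mod_cast Nat.card_pos.ne'

theorem conj_card_inv : (starRingEnd ℂ) ((Nat.card G : ℂ)⁻¹) = (Nat.card G : ℂ)⁻¹ := by
  rw [map_inv₀, Complex.conj_natCast]

theorem innerG_conj (f h : G → ℂ) : (starRingEnd ℂ) (innerG G f h) = innerG G h f := by
  simp only [innerG_eq_sum, map_mul, conj_card_inv, map_sum, Complex.conj_conj]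
  simp only [mul_comm]

theorem innerG_sub_self (f h : G → ℂ) :
    innerG G (f - h) (f - h) = innerG G f f - innerG G f h - innerG G h f + innerG G h h := by
  simp only [innerG_eq_sum, Pi.sub_apply, map_sub, ← mul_sub, ← mul_add,
    ← Finset.sum_sub_distrib, ← Finset.sum_add_distrib]
  congr 1
  exact Finset.sum_congr rfl fun x _ => by ring

theorem innerG_smul_self (c : ℂ) (f : G → ℂ) :
    innerG G (fun x => c * f x) (fun x => c * f x) =
      c * (starRingEnd ℂ) c * innerG G f f := by
  simp only [innerG_eq_sum, map_mul, Finset.mul_sum]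
  exact Finset.sum_congr rfl fun x _ => by ring

theorem innerG_self_eq (f : G → ℂ) :
    innerG G f f = (((Nat.card G : ℝ)⁻¹ * ∑ x : G, Complex.normSq (f x) : ℝ) : ℂ) := by
  rw [innerG_eq_sum]
  push_cast
  simp only [Complex.mul_conj]

theorem innerG_self_nonneg (f : G → ℂ) : 0 ≤ innerG G f f := by
  rw [innerG_self_eq]
  have : (0 : ℝ) ≤ (Nat.card G : ℝ)⁻¹ * ∑ x : G, Complex.normSq (f x) :=
    mul_nonneg (by positivity) (Finset.sum_nonneg fun x _ => Complex.normSq_nonneg _)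
  exact_mod_cast this

theorem eq_zero_of_innerG_self (f : G → ℂ) (h : innerG G f f = 0) : f = 0 := by
  rw [innerG_self_eq] at h
  have h1 : (Nat.card G : ℝ)⁻¹ * ∑ x : G, Complex.normSq (f x) = 0 := by exact_mod_cast h
  have h2 : ∑ x : G, Complex.normSq (f x) = 0 := by
    rcases mul_eq_zero.mp h1 with h' | h'
    · exact absurd (inv_eq_zero.mp h') (by exact_mod_cast Nat.card_pos.ne')
    · exact h'
  funext x
  have := (Finset.sum_eq_zero_iff_of_nonneg fun x _ => Complex.normSq_nonneg (f x)).mp h2 x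
    (Finset.mem_univ x)
  exact Complex.normSq_eq_zero.mp this

/-- `f` is constant on conjugacy classes. -/
def IsClassFun (f : G → ℂ) : Prop := ∀ x y : G, f (y * x * y⁻¹) = f x

theorem IsClassFun.sub {f h : G → ℂ} (hf : IsClassFun f) (hh : IsClassFun h) :
    IsClassFun (f - h) := fun x y => by simp [hf x y, hh x y]

theorem IsCharacter.isClassFun {f : G → ℂ} (hf : IsCharacter G f) : IsClassFun f := by
  obtain ⟨V, rfl⟩ := hf
  exact fun x y => FDRep.char_conj V x y

/-- Induction of a function along a group homomorphism, by the Frobenius formula. -/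
def indHom (ι : S →* G) (f : S → ℂ) : G → ℂ := fun g =>
  (Nat.card S : ℂ)⁻¹ * ∑ x : G, ∑ h : S, if ι h = x * g * x⁻¹ then f h else 0

theorem indHom_isClassFun (ι : S →* G) (f : S → ℂ) : IsClassFun (indHom ι f) := by
  intro g y
  unfold indHom
  congr 1
  refine Fintype.sum_equiv (Equiv.mulRight y) _ _ fun x => ?_
  simp [mul_assoc]

theorem indHom_sub (ι : S →* G) (f h : S → ℂ) :
    indHom ι (f - h) = indHom ι f - indHom ι h := by
  funext g
  simp only [indHom, Pi.sub_apply, ← mul_sub, ← Finset.sum_sub_distrib]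
  congr 1
  refine Finset.sum_congr rfl fun x _ => Finset.sum_congr rfl fun k _ => ?_
  split_ifs <;> simp

theorem indHom_one (ι : S →* G) (hι : Function.Injective ι) (f : S → ℂ) :
    indHom ι f 1 = (Nat.card G : ℂ) / (Nat.card S : ℂ) * f 1 := by
  have h1 : ∀ h : S, ι h = 1 ↔ h = 1 := fun h => map_eq_one_iff ι hι
  simp only [indHom, mul_one, mul_inv_cancel, h1, Finset.sum_ite_eq', Finset.mem_univ, if_true,
    Finset.sum_const, Finset.card_univ, nsmul_eq_mul, Nat.card_eq_fintype_card]
  ring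

/-- Frobenius reciprocity for class functions. -/
theorem innerG_indHom_left (ι : S →* G) (f : S → ℂ) {φ : G → ℂ} (hφ : IsClassFun φ) :
    innerG G (indHom ι f) φ = innerG S f (fun s => φ (ι s)) := by
  have key : ∀ (x : G) (h : S), (∑ g : G, (if ι h = x * g * x⁻¹ then f h else 0) *
      (starRingEnd ℂ) (φ g)) = f h * (starRingEnd ℂ) (φ (ι h)) := by
    intro x h
    have h1 : ∀ g : G, ι h = x * g * x⁻¹ ↔ g = x⁻¹ * ι h * x := fun g => by
      constructor
      · intro e; rw [e]; group
      · rintro rfl; group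
    simp only [h1, ite_mul, zero_mul, Finset.sum_ite_eq', Finset.mem_univ, if_true]
    have := hφ (ι h) x⁻¹
    rw [inv_inv] at this
    rw [this]
  simp only [innerG_eq_sum, indHom]
  have : ∑ g : G, (Nat.card S : ℂ)⁻¹ * (∑ x : G, ∑ h : S, if ι h = x * g * x⁻¹ then f h else 0) *
      (starRingEnd ℂ) (φ g) = (Nat.card S : ℂ)⁻¹ * ∑ x : G, ∑ h : S,
        ∑ g : G, (if ι h = x * g * x⁻¹ then f h else 0) * (starRingEnd ℂ) (φ g) := by
    simp only [Finset.mul_sum, Finset.sum_mul]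
    rw [Finset.sum_comm]
    refine Finset.sum_congr rfl fun x _ => ?_
    rw [Finset.sum_comm]
    simp only [mul_assoc]
  rw [this]
  simp only [key, Finset.sum_const, Finset.card_univ, nsmul_eq_mul, ← Nat.card_eq_fintype_card]
  have := card_ne_zero' (G := G)
  field_simp

/-- Mackey's criterion: induction is isometric on class functions that transform by `τ` under
translation by `N`, provided `τ` separates the conjugates of `N` by elements outside of `S`. -/
theorem innerG_indHom_indHom (ι : S →* G) (hι : Function.Injective ι) (N : Subgroup S)
    (τ : S → ℂ) (hτ : ∀ z ∈ N, τ z * (starRingEnd ℂ) (τ z) = 1)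
    (hsep : ∀ x : G, x ∉ Set.range ι →
      ∃ z ∈ N, ∃ w ∈ N, ι w = x * ι z * x⁻¹ ∧ τ z ≠ τ w)
    {f f' : S → ℂ} (hf' : IsClassFun f')
    (hfτ : ∀ s, ∀ z ∈ N, f (s * z) = f s * τ z)
    (hfτ' : ∀ s, ∀ z ∈ N, f' (s * z) = f' s * τ z) :
    innerG G (indHom ι f) (indHom ι f') = innerG S f f' := by
  rw [innerG_indHom_left ι f (indHom_isClassFun ι f')]
  set A : G → ℂ := fun x => ∑ s : S, ∑ h : S,
    if ι h = x * ι s * x⁻¹ then f s * (starRingEnd ℂ) (f' h) else 0 with hA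
  have hA0 : ∀ x ∉ Set.range ι, A x = 0 := by
    intro x hx
    obtain ⟨z, hz, w, hw, hzw, hne⟩ := hsep x hx
    have h1 : A x = τ z * (starRingEnd ℂ) (τ w) * A x := by
      conv_lhs => rw [hA]
      simp only [hA, Finset.mul_sum]
      symm
      refine Fintype.sum_equiv (Equiv.mulRight z) _ _ fun s => ?_
      refine Fintype.sum_equiv (Equiv.mulRight w) _ _ fun h => ?_
      simp only [Equiv.coe_mulRight, map_mul, hfτ s z hz, hfτ' h w hw]
      have h2 : ι h * ι w = x * (ι s * ι z) * x⁻¹ ↔ ι h = x * ι s * x⁻¹ := by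
        rw [hzw]
        constructor
        · intro e
          have := congrArg (· * (x * ι z * x⁻¹)⁻¹) e
          simpa [mul_assoc] using this
        · intro e; rw [e]; group
      simp only [h2]
      split_ifs
      · ring
      · ring
    have h3 : τ z * (starRingEnd ℂ) (τ w) ≠ 1 := by
      intro e
      apply hne
      calc τ z = τ z * (τ w * (starRingEnd ℂ) (τ w)) := by rw [hτ w hw, mul_one]
        _ = (τ z * (starRingEnd ℂ) (τ w)) * τ w := by ring
        _ = τ w := by rw [e, one_mul]
    have h4 : (1 - τ z * (starRingEnd ℂ) (τ w)) * A x = 0 := by linear_combination h1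
    exact (mul_eq_zero.mp h4).resolve_left (sub_ne_zero.mpr h3.symm)
  have hA1 : ∀ t : S, ∑ s : S, f s * (starRingEnd ℂ) (f' s) = A (ι t) := by
    intro t
    simp only [hA]
    refine Finset.sum_congr rfl fun s _ => ?_
    have h1 : ∀ h : S, ι h = ι t * ι s * (ι t)⁻¹ ↔ h = t * s * t⁻¹ := fun h => by
      rw [← map_inv, ← map_mul, ← map_mul]; exact hι.eq_iff
    simp only [h1, Finset.sum_ite_eq', Finset.mem_univ, if_true, hf' s t]
  have hsum : ∑ t : S, ∑ s : S, f s * (starRingEnd ℂ) (f' s) = ∑ x : G, A x :=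
    Fintype.sum_of_injective ι hι _ _ hA0 hA1
  have hsum2 : ∑ x : G, A x = ∑ s : S, f s * (starRingEnd ℂ)
      (∑ x : G, ∑ h : S, if ι h = x * ι s * x⁻¹ then f' h else 0) := by
    simp only [hA, map_sum, Finset.mul_sum]
    rw [Finset.sum_comm]
    refine Finset.sum_congr rfl fun s _ => Finset.sum_congr rfl fun x _ =>
      Finset.sum_congr rfl fun h _ => ?_
    split_ifs <;> simp
  simp only [innerG_eq_sum, indHom, map_mul, conj_card_inv]
  have h5 : ∀ s : S, f s * ((Nat.card S : ℂ)⁻¹ * (starRingEnd ℂ)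
      (∑ x : G, ∑ h : S, if ι h = x * ι s * x⁻¹ then f' h else 0)) =
      (Nat.card S : ℂ)⁻¹ * (f s * (starRingEnd ℂ)
      (∑ x : G, ∑ h : S, if ι h = x * ι s * x⁻¹ then f' h else 0)) := fun s => by ring
  simp only [h5, ← Finset.mul_sum]
  rw [← hsum2, ← hsum]
  simp only [Finset.sum_const, Finset.card_univ, nsmul_eq_mul, ← Nat.card_eq_fintype_card]
  have := card_ne_zero' (G := S)
  field_simp

/-! ### Characters -/

theorem isCharacter_of_trace {W : Type} [AddCommGroup W] [Module ℂ W] [Module.Finite ℂ W]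
    (ρ : G →* (W →ₗ[ℂ] W)) (f : G → ℂ) (hf : ∀ g, f g = LinearMap.trace ℂ W (ρ g)) :
    IsCharacter G f :=
  ⟨FDRep.of ρ, funext hf⟩

/-- The restriction of a representation to an invariant subspace. -/
def subRep {E : Type} [AddCommGroup E] [Module ℂ E] (σ : G →* (E →ₗ[ℂ] E)) (p : Submodule ℂ E)
    (hp : ∀ g, ∀ x ∈ p, σ g x ∈ p) : G →* (p →ₗ[ℂ] p) where
  toFun g := (σ g).restrict (hp g)
  map_one' := by ext x; simp
  map_mul' g h := by ext x; simp

theorem trace_subRep {E : Type} [AddCommGroup E] [Module ℂ E] [Module.Finite ℂ E]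
    (σ : G →* (E →ₗ[ℂ] E)) (p : Submodule ℂ E) (hp : ∀ g, ∀ x ∈ p, σ g x ∈ p)
    (P : E →ₗ[ℂ] E) (hP : ∀ x, P x ∈ p) (hP' : ∀ x ∈ p, P x = x) (g : G) :
    LinearMap.trace ℂ p (subRep σ p hp g) = LinearMap.trace ℂ E (σ g ∘ₗ P) := by
  rw [← LinearMap.trace_restrict_eq_of_forall_mem p (σ g ∘ₗ P) (fun x => hp g _ (hP x))]
  congr 1
  ext x
  simp [subRep, hP' x.1 x.2]

theorem trace_pi {ι V : Type} [Fintype ι] [AddCommGroup V] [Module ℂ V] [Module.Finite ℂ V]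
    (A : (ι → V) →ₗ[ℂ] (ι → V)) :
    LinearMap.trace ℂ (ι → V) A = ∑ i, LinearMap.trace ℂ V
      (LinearMap.proj i ∘ₗ A ∘ₗ LinearMap.single ℂ (fun _ => V) i) := by
  have h : A = ∑ i, (A ∘ₗ LinearMap.single ℂ (fun _ => V) i) ∘ₗ LinearMap.proj i := by
    ext i v j
    simp only [LinearMap.comp_apply, LinearMap.sum_apply, LinearMap.proj_apply]
    rw [Finset.sum_eq_single i]
    · simp
    · intro b _ hb; simp [hb]
    · simp
  conv_lhs => rw [h]
  rw [map_sum]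
  refine Finset.sum_congr rfl fun i _ => ?_
  rw [LinearMap.trace_comp_comm']

/-- The function induced from a character is a character. -/
theorem indHom_isCharacter (ι : S →* G) {f : S → ℂ} (hf : IsCharacter S f) :
    IsCharacter G (indHom ι f) := by
  obtain ⟨V, rfl⟩ := hf
  let σ : G →* ((G → V) →ₗ[ℂ] (G → V)) :=
    { toFun := fun g => LinearMap.funLeft ℂ V (fun x => x * g)
      map_one' := by ext; simp
      map_mul' := fun g h => by
        apply LinearMap.ext; intro φ; funext x
        simp [LinearMap.funLeft_apply, mul_assoc] }
  let p : Submodule ℂ (G → V) :=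
    { carrier := {φ | ∀ s x, φ (ι s * x) = V.ρ s (φ x)}
      zero_mem' := fun s x => by simp
      add_mem' := fun {a b} ha hb s x => by simp [ha s x, hb s x]
      smul_mem' := fun c a ha s x => by simp [ha s x] }
  let P : (G → V) →ₗ[ℂ] (G → V) := (Nat.card S : ℂ)⁻¹ • ∑ s : S,
    LinearMap.pi fun x => V.ρ s⁻¹ ∘ₗ LinearMap.proj (ι s * x)
  have hPa : ∀ φ x, P φ x = (Nat.card S : ℂ)⁻¹ • ∑ s : S, V.ρ s⁻¹ (φ (ι s * x)) := by
    intro φ x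
    simp [P, Finset.sum_apply]
  have hp : ∀ g, ∀ x ∈ p, σ g x ∈ p := by
    intro g φ hφ s x
    change φ (ι s * x * g) = V.ρ s (φ (x * g))
    rw [mul_assoc]; exact hφ s _
  have hP : ∀ φ, P φ ∈ p := by
    intro φ t x
    rw [hPa, hPa, map_smul, map_sum]
    congr 1
    refine Fintype.sum_equiv (Equiv.mulRight t) _ _ fun s => ?_
    rw [← Module.End.mul_apply, ← map_mul]
    simp [mul_assoc]
  have hP' : ∀ φ ∈ p, P φ = φ := by
    intro φ hφ
    funext x
    rw [hPa]
    have : ∀ s : S, V.ρ s⁻¹ (φ (ι s * x)) = φ x := fun s => by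
      rw [hφ s x, ← Module.End.mul_apply, ← map_mul]; simp
    simp only [this, Finset.sum_const, Finset.card_univ, ← Nat.card_eq_fintype_card]
    rw [← Nat.cast_smul_eq_nsmul ℂ, smul_smul, inv_mul_cancel₀ card_ne_zero', one_smul]
  refine isCharacter_of_trace (subRep σ p hp) _ fun g => ?_
  rw [trace_subRep σ p hp P hP hP' g, trace_pi]
  unfold indHom
  rw [Finset.mul_sum]
  refine Finset.sum_congr rfl fun x _ => ?_
  have hop : LinearMap.proj x ∘ₗ (σ g ∘ₗ P) ∘ₗ LinearMap.single ℂ (fun _ => (V : Type)) x =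
      (Nat.card S : ℂ)⁻¹ • ∑ s : S, if ι s = x * g⁻¹ * x⁻¹ then V.ρ s⁻¹ else 0 := by
    apply LinearMap.ext
    intro v
    change P (Pi.single x v) (x * g) = _
    rw [hPa, LinearMap.smul_apply, LinearMap.sum_apply]
    congr 1
    refine Finset.sum_congr rfl fun s _ => ?_
    have h1 : ι s = x * g⁻¹ * x⁻¹ ↔ ι s * (x * g) = x := by
      constructor
      · intro e; rw [e]; group
      · intro e; rw [eq_mul_inv_iff_mul_eq, eq_mul_inv_iff_mul_eq]; simpa [mul_assoc] using e
    by_cases h : ι s = x * g⁻¹ * x⁻¹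
    · rw [if_pos h, h1.mp h, Pi.single_eq_same]
    · rw [if_neg h, Pi.single_eq_of_ne (fun e => h (h1.mpr e)), map_zero, LinearMap.zero_apply]
  rw [hop, map_smul, map_sum, smul_eq_mul]
  congr 1
  refine Fintype.sum_equiv (Equiv.inv S) _ _ fun s => ?_
  have h2 : ι s = x * g * x⁻¹ ↔ ι s⁻¹ = x * g⁻¹ * x⁻¹ := by
    rw [map_inv, inv_eq_iff_eq_inv]; simp [mul_assoc]
  simp only [Equiv.inv_apply, h2, inv_inv]
  split_ifs
  · rfl
  · simp

/-- For characters of a finite group, inversion is complex conjugation. -/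
theorem IsCharacter.inv_eq_conj {f : G → ℂ} (hf : IsCharacter G f) (g : G) :
    f g⁻¹ = (starRingEnd ℂ) (f g) := by
  obtain ⟨V, rfl⟩ := hf
  let b := Module.finBasis ℂ V
  let M : G → Matrix _ _ ℂ := fun g => LinearMap.toMatrix b b (V.ρ g)
  have hM1 : M 1 = 1 := by simp only [M, map_one]; exact LinearMap.toMatrix_one b
  have hMm : ∀ g h, M (g * h) = M g * M h := fun g h => by
    simp only [M, map_mul]; exact LinearMap.toMatrix_mul b _ _
  have htr : ∀ g, V.character g = (M g).trace := fun g =>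
    LinearMap.trace_eq_matrix_trace ℂ b (V.ρ g)
  let P := ∑ h : G, (M h).conjTranspose * M h
  have hP : P.PosDef := by
    simp only [P]
    rw [← Finset.add_sum_erase _ _ (Finset.mem_univ (1 : G))]
    refine Matrix.PosDef.add_posSemidef ?_ ?_
    · rw [hM1]; simpa using Matrix.PosDef.one
    · exact Matrix.posSemidef_sum _ fun i _ => Matrix.posSemidef_conjTranspose_mul_self (M i)
  have hPu : IsUnit P.det := (Matrix.isUnit_iff_isUnit_det P).mp hP.isUnit
  have hinv : (M g).conjTranspose * P * M g = P := by
    simp only [P, Finset.mul_sum, Finset.sum_mul]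
    refine Fintype.sum_equiv (Equiv.mulRight g) _ _ fun h => ?_
    simp [hMm, Matrix.mul_assoc]
  have hgi : M g * M g⁻¹ = 1 := by rw [← hMm, mul_inv_cancel, hM1]
  have h1 : P * M g⁻¹ = (M g).conjTranspose * P := by
    calc P * M g⁻¹ = (M g).conjTranspose * P * (M g * M g⁻¹) := by
          rw [← Matrix.mul_assoc, hinv]
      _ = _ := by rw [hgi, Matrix.mul_one]
  have h2 : M g⁻¹ = P⁻¹ * ((M g).conjTranspose * P) := by
    rw [← h1, ← Matrix.mul_assoc, Matrix.nonsing_inv_mul P hPu, Matrix.one_mul]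
  rw [htr, htr, h2, Matrix.trace_mul_comm, Matrix.mul_assoc, Matrix.mul_nonsing_inv P hPu,
    Matrix.mul_one, Matrix.trace_conjTranspose]
  rfl

open CategoryTheory in
theorem IsCharacter.exists_innerG_self {f : G → ℂ} (hf : IsCharacter G f) :
    ∃ n : ℕ, innerG G f f = n := by
  have hf' := hf
  obtain ⟨V, rfl⟩ := hf'
  have : Invertible (Nat.card G : ℂ) := invertibleOfNonzero card_ne_zero'
  refine ⟨Module.finrank ℂ (V ⟶ V), ?_⟩
  rw [innerG_eq_sum, ← FDRep.scalar_product_char_eq_finrank_equivariant V V]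
  congr 1
  exact Finset.sum_congr rfl fun x _ => by rw [hf.inv_eq_conj]

theorem sum_subgroup (N : Subgroup S) (F : S → ℂ) :
    ∑ z : N, F z = ∑ s : S, if s ∈ N then F s else 0 := by
  rw [← Finset.sum_filter]
  exact (Finset.sum_subtype _ (fun x => by simp) F).symm

theorem sum_quotient (K : Subgroup S) (F : S ⧸ K → ℂ) :
    ∑ s : S, F (QuotientGroup.mk s) = (Nat.card K : ℂ) * ∑ x : S ⧸ K, F x := by
  rw [Fintype.sum_equiv (Subgroup.groupEquivQuotientProdSubgroup (s := K))
    (fun s => F (QuotientGroup.mk s)) (fun y => F y.1) fun s => rfl, Fintype.sum_prod_type]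
  simp [Finset.mul_sum]

theorem innerG_quotient (K : Subgroup S) [K.Normal] (f h : S ⧸ K → ℂ) :
    innerG S (fun s => f (QuotientGroup.mk s)) (fun s => h (QuotientGroup.mk s)) =
      innerG (S ⧸ K) f h := by
  rw [innerG_eq_sum, innerG_eq_sum,
    sum_quotient K (fun x => f x * (starRingEnd ℂ) (h x)),
    Subgroup.card_eq_card_quotient_mul_card_subgroup K]
  have h1 := card_ne_zero' (G := S ⧸ K)
  have h2 := card_ne_zero' (G := K)
  push_cast
  field_simp

theorem isCharacter_inflate (K : Subgroup S) [K.Normal] {f : S ⧸ K → ℂ}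
    (hf : IsCharacter (S ⧸ K) f) : IsCharacter S (fun s => f (QuotientGroup.mk s)) := by
  obtain ⟨V, rfl⟩ := hf
  exact isCharacter_of_trace (V.ρ.comp (QuotientGroup.mk' K)) _ fun g => rfl

/-- `τ` restricts to an `S`-invariant linear character of the subgroup `N`. -/
structure IsStableLinear (N : Subgroup S) (τ : S → ℂ) : Prop where
  map_one : τ 1 = 1
  map_mul : ∀ z ∈ N, ∀ w ∈ N, τ (z * w) = τ z * τ w
  map_conj : ∀ z ∈ N, (starRingEnd ℂ) (τ z) = τ z⁻¹
  invariant : ∀ z ∈ N, ∀ s, τ (s * z * s⁻¹) = τ z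

theorem IsStableLinear.mul_inv {N : Subgroup S} {τ : S → ℂ} (h : IsStableLinear N τ) {z : S}
    (hz : z ∈ N) : τ z * τ z⁻¹ = 1 := by
  rw [← h.map_mul z hz _ (inv_mem hz), mul_inv_cancel, h.map_one]

/-- The `τ`-isotypic subspace. -/
def isoSub (V : FDRep ℂ S) (N : Subgroup S) (τ : S → ℂ) : Submodule ℂ V where
  carrier := {v | ∀ z ∈ N, V.ρ z v = τ z • v}
  zero_mem' := fun z _ => by simp
  add_mem' := fun {a b} ha hb z hz => by rw [map_add, ha z hz, hb z hz, smul_add]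
  smul_mem' := fun c a ha z hz => by rw [map_smul, ha z hz, smul_comm]

/-- The projection onto the `τ`-isotypic subspace. -/
def isoProj (V : FDRep ℂ S) (N : Subgroup S) (τ : S → ℂ) : V →ₗ[ℂ] V :=
  (Nat.card N : ℂ)⁻¹ • ∑ z : N, τ (z : S)⁻¹ • V.ρ z

theorem isoProj_isProj (V : FDRep ℂ S) (N : Subgroup S) {τ : S → ℂ} (hτ : IsStableLinear N τ) :
    LinearMap.IsProj (isoSub V N τ) (isoProj V N τ) := by
  constructor
  · intro v w hw
    simp only [isoProj, LinearMap.smul_apply, LinearMap.sum_apply, map_smul, map_sum]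
    rw [smul_comm]
    congr 1
    rw [Finset.smul_sum]
    refine Fintype.sum_equiv (Equiv.mulLeft ⟨w, hw⟩) _ _ fun z => ?_
    simp only [Equiv.coe_mulLeft, Subgroup.coe_mul, mul_inv_rev, map_mul]
    rw [hτ.map_mul _ (inv_mem z.2) _ (inv_mem hw), smul_smul, Module.End.mul_apply]
    congr 1
    linear_combination (-τ (z : S)⁻¹) * hτ.mul_inv hw
  · intro v hv
    have h : ∀ z : N, τ (z : S)⁻¹ • V.ρ z v = v := fun z => by
      rw [hv z z.2, smul_smul, mul_comm, hτ.mul_inv z.2, one_smul]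
    simp only [isoProj, LinearMap.smul_apply, LinearMap.sum_apply, h, Finset.sum_const,
      Finset.card_univ, ← Nat.card_eq_fintype_card]
    rw [← Nat.cast_smul_eq_nsmul ℂ, smul_smul, inv_mul_cancel₀ card_ne_zero', one_smul]

theorem trace_comp_isoProj (V : FDRep ℂ S) (N : Subgroup S) (τ : S → ℂ) (s : S) :
    LinearMap.trace ℂ V (V.ρ s ∘ₗ isoProj V N τ) =
      (Nat.card N : ℂ)⁻¹ * ∑ z : N, τ (z : S)⁻¹ * V.character (s * z) := by
  simp only [isoProj, ← Module.End.mul_eq_comp, Finset.mul_sum, mul_smul_comm, map_smul, map_sum,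
    smul_eq_mul, FDRep.character, map_mul]

theorem isoSub_invariant (V : FDRep ℂ S) (N : Subgroup S) [N.Normal] {τ : S → ℂ}
    (hτ : IsStableLinear N τ) (s : S) : ∀ v ∈ isoSub V N τ, V.ρ s v ∈ isoSub V N τ := by
  intro v hv z hz
  have h1 : s⁻¹ * z * s ∈ N := by
    simpa using Subgroup.Normal.conj_mem (inferInstance : N.Normal) z hz s⁻¹
  have h2 : τ (s⁻¹ * z * s) = τ z := by simpa using hτ.invariant z hz s⁻¹
  have h3 : z * s = s * (s⁻¹ * z * s) := by group
  rw [← Module.End.mul_apply, ← map_mul, h3, map_mul, Module.End.mul_apply, hv _ h1, h2, map_smul]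

/-- The `τ`-isotypic part of a character, as a character of a quotient by a subgroup
of the kernel of `τ`. -/
theorem exists_isotypic (N K : Subgroup S) [N.Normal] [K.Normal] (hKN : K ≤ N) {τ : S → ℂ}
    (hτ : IsStableLinear N τ) (hK : ∀ z ∈ K, τ z = 1) {ψ : S → ℂ} (hψ : IsCharacter S ψ) :
    ∃ f : S ⧸ K → ℂ, IsCharacter (S ⧸ K) f ∧ ∀ s : S, f (QuotientGroup.mk s) =
      (Nat.card N : ℂ)⁻¹ * ∑ z : N, τ (z : S)⁻¹ * ψ (s * z) := by
  obtain ⟨V, rfl⟩ := hψ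
  let σ := subRep V.ρ (isoSub V N τ) (isoSub_invariant V N hτ)
  have hσ : K ≤ σ.ker := by
    intro z hz
    rw [MonoidHom.mem_ker]
    apply LinearMap.ext
    intro v
    apply Subtype.ext
    change V.ρ z v = v
    rw [v.2 z (hKN hz), hK z hz, one_smul]
  let σ' := QuotientGroup.lift K σ hσ
  refine ⟨fun q => LinearMap.trace ℂ _ (σ' q), isCharacter_of_trace σ' _ fun _ => rfl, fun s => ?_⟩
  have hP := isoProj_isProj V N hτ
  rw [← trace_comp_isoProj V N τ s,
    ← trace_subRep V.ρ (isoSub V N τ) (isoSub_invariant V N hτ) _ hP.1 hP.2 s]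
  rfl

/-- If a character restricts to a multiple of `τ` on `N`, then `N` acts through `τ`. -/
theorem IsCharacter.map_mul_of_restrict (N : Subgroup S) {τ : S → ℂ} (hτ : IsStableLinear N τ)
    {f : S → ℂ} (hf : IsCharacter S f) (hfN : ∀ z ∈ N, f z = f 1 * τ z) (s z : S) (hz : z ∈ N) :
    f (s * z) = f s * τ z := by
  obtain ⟨V, rfl⟩ := hf
  have hP := isoProj_isProj V N hτ
  have htr := trace_comp_isoProj V N τ 1
  have h1 : ∀ w : N, τ (w : S)⁻¹ * V.character (1 * w) = V.character 1 := fun w => by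
    rw [one_mul, hfN w w.2]; linear_combination V.character 1 * hτ.mul_inv w.2
  simp only [h1, Finset.sum_const, Finset.card_univ, ← Nat.card_eq_fintype_card, nsmul_eq_mul]
    at htr
  rw [inv_mul_cancel_left₀ card_ne_zero', map_one, Module.End.one_eq_id, LinearMap.id_comp,
    hP.trace, FDRep.char_one] at htr
  have htop : isoSub V N τ = ⊤ := Submodule.eq_top_of_finrank_eq (by exact_mod_cast htr)
  have hz' : V.ρ z = τ z • (1 : V →ₗ[ℂ] V) := by
    apply LinearMap.ext
    intro v
    have : v ∈ isoSub V N τ := htop ▸ Submodule.mem_top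
    exact this z hz
  simp only [FDRep.character, map_mul, hz', mul_smul_comm, mul_one, map_smul, smul_eq_mul]
  ring

/-- The data under which induction from `S` to `G` restricts to a bijection between the irreducible
characters of `S` lying over `τ` and those of `G`. -/
structure IsMackeyDatum (ι : S →* G) (N : Subgroup S) (τ : S → ℂ) : Prop where
  injective : Function.Injective ι
  stable : IsStableLinear N τ
  separates : ∀ x : G, x ∉ Set.range ι →
    ∃ z ∈ N, ∃ w ∈ N, ι w = x * ι z * x⁻¹ ∧ τ z ≠ τ w

theorem IsMackeyDatum.innerG_indHom {ι : S →* G} {N : Subgroup S} {τ : S → ℂ}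
    (h : IsMackeyDatum ι N τ) {f f' : S → ℂ} (hf' : IsClassFun f')
    (hfτ : ∀ s, ∀ z ∈ N, f (s * z) = f s * τ z)
    (hfτ' : ∀ s, ∀ z ∈ N, f' (s * z) = f' s * τ z) :
    innerG G (indHom ι f) (indHom ι f') = innerG S f f' :=
  innerG_indHom_indHom ι h.injective N τ
    (fun z hz => by rw [h.stable.map_conj z hz, h.stable.mul_inv hz]) h.separates hf' hfτ hfτ'

theorem IsMackeyDatum.indHom_injective {ι : S →* G} {N : Subgroup S} {τ : S → ℂ}
    (h : IsMackeyDatum ι N τ) {f f' : S → ℂ} (hf : IsClassFun f) (hf' : IsClassFun f')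
    (hfτ : ∀ s, ∀ z ∈ N, f (s * z) = f s * τ z)
    (hfτ' : ∀ s, ∀ z ∈ N, f' (s * z) = f' s * τ z)
    (he : indHom ι f = indHom ι f') : f = f' := by
  have h1 : ∀ s, ∀ z ∈ N, (f - f') (s * z) = (f - f') s * τ z := fun s z hz => by
    simp only [Pi.sub_apply, hfτ s z hz, hfτ' s z hz, sub_mul]
  have h2 := h.innerG_indHom (hf.sub hf') h1 h1
  rw [indHom_sub, he, sub_self] at h2
  have h3 : innerG G (0 : G → ℂ) 0 = 0 := by simp [innerG_eq_sum]
  exact sub_eq_zero.mp (eq_zero_of_innerG_self _ (h2.symm.trans h3))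

theorem IsMackeyDatum.sum_indHom {ι : S →* G} {N : Subgroup S} {τ : S → ℂ}
    (h : IsMackeyDatum ι N τ) {f : S → ℂ} (hf : IsClassFun f)
    (hfτ : ∀ s, ∀ z ∈ N, f (s * z) = f s * τ z) :
    ∑ z : N, τ z * (starRingEnd ℂ) (indHom ι f (ι z)) =
      (Nat.card N : ℂ) * (starRingEnd ℂ) (f 1) := by
  let f₀ : S → ℂ := fun s => if s ∈ N then τ s else 0
  have h0 : ∀ s, ∀ z ∈ N, f₀ (s * z) = f₀ s * τ z := by
    intro s z hz
    simp only [f₀, Subgroup.mul_mem_cancel_right N hz]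
    split_ifs with hs
    · exact h.stable.map_mul s hs z hz
    · simp
  have h1 := h.innerG_indHom hf h0 hfτ
  rw [innerG_indHom_left ι f₀ (indHom_isClassFun ι f), innerG_eq_sum, innerG_eq_sum] at h1
  have h2 := mul_left_cancel₀ (inv_ne_zero card_ne_zero') h1
  simp only [f₀, ite_mul, zero_mul] at h2
  rw [← sum_subgroup N (fun s => τ s * (starRingEnd ℂ) (indHom ι f (ι s))),
    ← sum_subgroup N (fun s => τ s * (starRingEnd ℂ) (f s))] at h2
  rw [h2]
  have h3 : ∀ z : N, τ z * (starRingEnd ℂ) (f z) = (starRingEnd ℂ) (f 1) := fun z => by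
    have := hfτ 1 z z.2
    rw [one_mul] at this
    rw [this, map_mul, h.stable.map_conj z z.2]
    linear_combination (starRingEnd ℂ) (f 1) * h.stable.mul_inv z.2
  simp only [h3, Finset.sum_const, Finset.card_univ, ← Nat.card_eq_fintype_card, nsmul_eq_mul]

/-- Induction preserves irreducibility of characters lying over `τ`. -/
theorem IsMackeyDatum.indHom_mem_Irr {ι : S →* G} {N : Subgroup S} {τ : S → ℂ}
    (h : IsMackeyDatum ι N τ) {f : S → ℂ} (hf : f ∈ Irr S)
    (hfτ : ∀ s, ∀ z ∈ N, f (s * z) = f s * τ z) : indHom ι f ∈ Irr G :=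
  ⟨indHom_isCharacter ι hf.1, by rw [h.innerG_indHom hf.1.isClassFun hfτ hfτ, hf.2]⟩

/-- Every irreducible character of `G` lying over `τ` is induced from one of `S` lying
over `τ`. -/
theorem IsMackeyDatum.exists_indHom_eq {ι : S →* G} {N : Subgroup S} {τ : S → ℂ}
    (h : IsMackeyDatum ι N τ) [N.Normal] (K : Subgroup S) [K.Normal] (hKN : K ≤ N)
    (hK : ∀ z ∈ K, τ z = 1) {ψ : G → ℂ} (hψ : ψ ∈ Irr G)
    (hne : ∑ z : N, τ z * (starRingEnd ℂ) (ψ (ι z)) ≠ 0) :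
    ∃ f ∈ Irr (S ⧸ K), (∀ z ∈ N, f (QuotientGroup.mk z) = f 1 * τ z) ∧
      indHom ι (fun s => f (QuotientGroup.mk s)) = ψ := by
  have hres : IsCharacter S (fun s => ψ (ι s)) := by
    obtain ⟨V, rfl⟩ := hψ.1
    exact isCharacter_of_trace (V.ρ.comp ι) _ fun g => rfl
  obtain ⟨f, hf, hfs⟩ := exists_isotypic N K hKN h.stable hK hres
  set F : S → ℂ := fun s => f (QuotientGroup.mk s) with hF
  have hFchar : IsCharacter S F := isCharacter_inflate K hf
  have hFτ : ∀ s, ∀ z ∈ N, F (s * z) = F s * τ z := by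
    intro s z hz
    simp only [hF, hfs]
    rw [mul_assoc]
    congr 1
    rw [Finset.sum_mul]
    refine Fintype.sum_equiv (Equiv.mulLeft ⟨z, hz⟩) _ _ fun w => ?_
    simp only [Equiv.coe_mulLeft, Subgroup.coe_mul, mul_inv_rev, map_mul, mul_assoc]
    rw [h.stable.map_mul _ (inv_mem w.2) _ (inv_mem hz)]
    linear_combination (-τ (w : S)⁻¹ * ψ (ι s * (ι z * ι w))) * h.stable.mul_inv hz
  have hFψ : innerG S F (fun s => ψ (ι s)) = innerG S F F := by
    simp only [innerG_eq_sum]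
    congr 1
    have e1 : ∀ z : N, ∑ s : S, F s * (starRingEnd ℂ) (ψ (ι s)) =
        ∑ s : S, F s * τ z * (starRingEnd ℂ) (ψ (ι (s * z))) := fun z => by
      refine (Fintype.sum_equiv (Equiv.mulRight (z : S)) _ _ fun s => ?_).symm
      simp only [Equiv.coe_mulRight, hFτ s z z.2]
    have e2 : ∀ s, (starRingEnd ℂ) (F s) = (Nat.card N : ℂ)⁻¹ *
        ∑ z : N, τ z * (starRingEnd ℂ) (ψ (ι (s * z))) := fun s => by
      simp only [hF, hfs, map_mul, conj_card_inv, map_sum]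
      congr 1
      refine Finset.sum_congr rfl fun z _ => ?_
      rw [h.stable.map_conj _ (inv_mem z.2), inv_inv]
    calc ∑ s : S, F s * (starRingEnd ℂ) (ψ (ι s))
        = (Nat.card N : ℂ)⁻¹ * ∑ z : N, ∑ s : S, F s * (starRingEnd ℂ) (ψ (ι s)) := by
          rw [Finset.sum_const, Finset.card_univ, ← Nat.card_eq_fintype_card, nsmul_eq_mul,
            inv_mul_cancel_left₀ card_ne_zero']
      _ = ∑ s : S, F s * ((Nat.card N : ℂ)⁻¹ *
            ∑ z : N, τ z * (starRingEnd ℂ) (ψ (ι (s * z)))) := by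
          rw [Finset.sum_congr rfl fun z _ => e1 z, Finset.sum_comm, Finset.mul_sum]
          refine Finset.sum_congr rfl fun s _ => ?_
          simp only [Finset.mul_sum]
          exact Finset.sum_congr rfl fun z _ => by ring
      _ = _ := Finset.sum_congr rfl fun s _ => by rw [e2]
  have hFclass := hFchar.isClassFun
  obtain ⟨n, hn⟩ := hFchar.exists_innerG_self
  have hIF : innerG G (indHom ι F) (indHom ι F) = n := by
    rw [h.innerG_indHom hFclass hFτ hFτ, hn]
  have hIψ : innerG G (indHom ι F) ψ = n := by
    rw [innerG_indHom_left ι F hψ.1.isClassFun, hFψ, hn]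
  have hψI : innerG G ψ (indHom ι F) = n := by
    rw [← innerG_conj, hIψ, Complex.conj_natCast]
  have hsub : innerG G (indHom ι F - ψ) (indHom ι F - ψ) = 1 - n := by
    rw [innerG_sub_self, hIF, hIψ, hψI, hψ.2]; ring
  have hF1 : F 1 ≠ 0 := by
    intro e
    apply hne
    have e3 := hfs 1
    change F 1 = _ at e3
    rw [e] at e3
    have e4 := (mul_eq_zero.mp e3.symm).resolve_left (inv_ne_zero card_ne_zero')
    have e5 := congrArg (starRingEnd ℂ) e4
    rw [map_zero, map_sum] at e5
    rw [← e5]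
    refine Finset.sum_congr rfl fun z _ => ?_
    rw [map_mul, h.stable.map_conj _ (inv_mem z.2), inv_inv, one_mul]
  have hn0 : n ≠ 0 := by
    rintro rfl
    apply hF1
    rw [eq_zero_of_innerG_self F (by rw [hn]; simp)]
    rfl
  have hn1 : n ≤ 1 := by
    have := innerG_self_nonneg (indHom ι F - ψ)
    rw [hsub, sub_nonneg] at this
    exact_mod_cast this
  have hn2 : n = 1 := by omega
  subst hn2
  refine ⟨f, ⟨hf, ?_⟩, fun z hz => ?_, ?_⟩
  · rw [← innerG_quotient K f f]; simpa using hn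
  · have := hFτ 1 z hz
    rw [one_mul] at this
    exact this
  · exact sub_eq_zero.mp (eq_zero_of_innerG_self _ (by rw [hsub]; simp))

end FiniteGroups

/-! ### Orbit sums -/

section Orbits

variable {Γ α : Type} [Group Γ] [Fintype Γ]

theorem card_fiber (a : Γ → α) (ha : ∀ g h, a g = a h → ∀ k, a (k * g) = a (k * h)) (k : Γ) :
    (Finset.univ.filter fun g => a g = a k).card =
      (Finset.univ.filter fun g => a g = a 1).card := by
  refine Finset.card_bij' (fun g _ => k⁻¹ * g) (fun g _ => k * g) ?_ ?_ ?_ ?_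
  · intro g hg
    simp only [Finset.mem_filter, Finset.mem_univ, true_and] at hg ⊢
    simpa using ha _ _ hg k⁻¹
  · intro g hg
    simp only [Finset.mem_filter, Finset.mem_univ, true_and] at hg ⊢
    simpa using ha _ _ hg k
  · intro g _; simp
  · intro g _; simp

theorem sum_eq_fiber_mul (a : Γ → α) (ha : ∀ g h, a g = a h → ∀ k, a (k * g) = a (k * h))
    (Φ : α → ℂ) : ∑ g, Φ (a g) =
      ((Finset.univ.filter fun g => a g = a 1).card : ℂ) * ∑ᶠ mu ∈ Set.range a, Φ mu := by
  have h1 : Set.range a = ↑(Finset.univ.image a) := by simp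
  rw [h1, finsum_mem_coe_finset, Finset.mul_sum, Finset.sum_comp]
  refine Finset.sum_congr rfl fun b hb => ?_
  obtain ⟨k, -, rfl⟩ := Finset.mem_image.mp hb
  rw [card_fiber a ha k, nsmul_eq_mul]

theorem card_eq_range_mul_fiber (a : Γ → α)
    (ha : ∀ g h, a g = a h → ∀ k, a (k * g) = a (k * h)) :
    Nat.card Γ = Nat.card (Set.range a) * (Finset.univ.filter fun g => a g = a 1).card := by
  have h1 : Set.range a = ↑(Finset.univ.image a) := by simp
  have h2 : Nat.card (Set.range a) = (Finset.univ.image a).card := by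
    rw [h1]; exact (Nat.card_coe_set_eq _).trans (Set.ncard_coe_finset _)
  rw [h2, Nat.card_eq_fintype_card, ← Finset.card_univ,
    Finset.card_eq_sum_card_image a Finset.univ, Finset.sum_const_nat]
  intro b hb
  obtain ⟨k, -, rfl⟩ := Finset.mem_image.mp hb
  exact card_fiber a ha k

theorem finsum_range_eq (a : Γ → α) (ha : ∀ g h, a g = a h → ∀ k, a (k * g) = a (k * h))
    (Φ : α → ℂ) : ∑ᶠ mu ∈ Set.range a, Φ mu =
      (Nat.card (Set.range a) : ℂ) / (Nat.card Γ : ℂ) * ∑ g, Φ (a g) := by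
  have h0 := card_ne_zero' (G := Γ)
  rw [sum_eq_fiber_mul a ha Φ]
  have h1 : (Nat.card Γ : ℂ) = Nat.card (Set.range a) *
      ((Finset.univ.filter fun g => a g = a 1).card : ℂ) := by
    exact_mod_cast card_eq_range_mul_fiber a ha
  rw [h1] at h0 ⊢
  have h2 := left_ne_zero_of_mul h0
  have h3 := right_ne_zero_of_mul h0
  field_simp

end Orbits

section Algebra

/-! ### Additive characters composed with linear functionals -/

theorem exists_theta_ne_one {θ : AddChar F ℂ} (hθ : θ ≠ 1) {W : Type} [AddCommGroup W]
    [Module F W] {l : W →ₗ[F] F} (hl : l ≠ 0) : ∃ X, θ (l X) ≠ 1 := by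
  obtain ⟨c, hc⟩ := AddChar.ne_one_iff.mp hθ
  obtain ⟨X, hX⟩ : ∃ X, l X ≠ 0 := by
    by_contra! h
    exact hl (LinearMap.ext h)
  refine ⟨(c / l X) • X, ?_⟩
  rw [map_smul, smul_eq_mul, div_mul_cancel₀ c hX]
  exact hc

theorem sum_theta {θ : AddChar F ℂ} (hθ : θ ≠ 1) {W : Type} [AddCommGroup W] [Module F W]
    [Fintype W] (l : W →ₗ[F] F) :
    ∑ X : W, θ (l X) = if l = 0 then (Nat.card W : ℂ) else 0 := by
  split_ifs with h
  · subst h; simp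
  · obtain ⟨X, hX⟩ := exists_theta_ne_one hθ h
    have h1 : ∑ Y : W, θ (l Y) = θ (l X) * ∑ Y : W, θ (l Y) := by
      rw [Finset.mul_sum]
      refine (Fintype.sum_equiv (Equiv.addLeft X) _ _ fun Y => ?_).symm
      rw [Equiv.coe_addLeft, map_add, AddChar.map_add_eq_mul]
    have h2 : (1 - θ (l X)) * ∑ Y : W, θ (l Y) = 0 := by linear_combination h1
    exact (mul_eq_zero.mp h2).resolve_left (sub_ne_zero.mpr hX.symm)

theorem theta_conj (θ : AddChar F ℂ) (x : F) : (starRingEnd ℂ) (θ x) = θ (-x) :=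
  (AddChar.map_neg_eq_conj θ x).symm

/-! ### Elements of algebra groups -/

theorem IsNil.mono {J a : NonUnitalSubalgebra F R} (hJ : IsNil J) (h : a ≤ J) : IsNil a := by
  obtain ⟨N, hN⟩ := hJ
  exact ⟨N, fun l hl => hN l fun x hx => h (hl x hx)⟩

theorem algGroup_mono {a J : NonUnitalSubalgebra F R} (h : a ≤ J) :
    algGroup F R a ≤ algGroup F R J := fun _ hu => ⟨h hu.1, h hu.2⟩

theorem mem_algGroup_of_sub_one_mem {J : NonUnitalSubalgebra F R} {u : Rˣ}
    (hu : (u : R) - 1 ∈ J) : u ∈ algGroup F R J := by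
  have hpow : ∀ k : ℕ, ((u ^ k : Rˣ) : R) - 1 ∈ J := by
    intro k
    induction k with
    | zero => simp
    | succ k ih =>
      have h : ((u ^ (k + 1) : Rˣ) : R) - 1 =
          (((u ^ k : Rˣ) : R) - 1) * ((u : R) - 1) + (((u ^ k : Rˣ) : R) - 1) +
            ((u : R) - 1) := by
        rw [pow_succ]; push_cast; noncomm_ring
      rw [h]
      exact add_mem (add_mem (mul_mem ih hu) ih) hu
  refine ⟨hu, ?_⟩
  have h1 : u⁻¹ = u ^ (orderOf u - 1) := by
    rw [inv_eq_iff_mul_eq_one, ← pow_succ', Nat.sub_add_cancel (orderOf_pos u),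
      pow_orderOf_eq_one]
  rw [h1]
  exact hpow _

theorem exists_algGroup_sub_one {J : NonUnitalSubalgebra F R} (hJ : IsNil J) {X : R}
    (hX : X ∈ J) : ∃ u : algGroup F R J, ((u : Rˣ) : R) - 1 = X := by
  obtain ⟨N, hN⟩ := hJ
  have h1 : X ^ N = 0 := by
    have := hN (List.replicate N X) (fun x hx => by rwa [List.eq_of_mem_replicate hx])
      List.length_replicate
    rwa [List.prod_replicate] at this
  obtain ⟨u, hu⟩ := (IsNilpotent.isUnit_one_add ⟨N, h1⟩ : IsUnit (1 + X))
  have h2 : (u : R) - 1 = X := by rw [hu]; simp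
  exact ⟨⟨u, mem_algGroup_of_sub_one_mem (by rwa [h2])⟩, h2⟩

theorem gElt_bijective {J : NonUnitalSubalgebra F R} (hJ : IsNil J) :
    Function.Bijective (gElt : algGroup F R J → J) := by
  constructor
  · intro g h e
    have := congrArg (fun x : J => (x : R)) e
    simp only [gElt, sub_left_inj] at this
    exact Subtype.ext (Units.ext this)
  · rintro ⟨X, hX⟩
    obtain ⟨u, hu⟩ := exists_algGroup_sub_one hJ hX
    exact ⟨u, Subtype.ext hu⟩

theorem unit_mul_mem {J : NonUnitalSubalgebra F R} (g : algGroup F R J) {X : R} (hX : X ∈ J) :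
    ((g : Rˣ) : R) * X ∈ J := (lmulMap g ⟨X, hX⟩).2

theorem mul_unit_mem {J : NonUnitalSubalgebra F R} (g : algGroup F R J) {X : R} (hX : X ∈ J) :
    X * ((g : Rˣ) : R) ∈ J := (rmulMap g ⟨X, hX⟩).2

theorem card_algGroup {J : NonUnitalSubalgebra F R} (hJ : IsNil J) :
    Nat.card (algGroup F R J) = Nat.card J :=
  Nat.card_congr (Equiv.ofBijective _ (gElt_bijective hJ))

theorem sum_gElt {J : NonUnitalSubalgebra F R} (hJ : IsNil J) (Φ : J → ℂ) :
    ∑ g : algGroup F R J, Φ (gElt g) = ∑ X : J, Φ X :=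
  Fintype.sum_bijective _ (gElt_bijective hJ) _ _ fun _ => rfl

/-! ### Restricting functionals on `R` -/

/-- The restriction of a functional on the ambient algebra to a subalgebra. -/
def rstr (a : NonUnitalSubalgebra F R) (M : R →ₗ[F] F) : a →ₗ[F] F where
  toFun x := M x
  map_add' x y := by simp
  map_smul' c x := by simp

@[simp]
theorem rstr_apply (a : NonUnitalSubalgebra F R) (M : R →ₗ[F] F) (x : a) : rstr a M x = M x :=
  rfl

theorem exists_rstr (a : NonUnitalSubalgebra F R) (mu : a →ₗ[F] F) : ∃ M, rstr a M = mu := by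
  let mu' : a.toSubmodule →ₗ[F] F :=
    { toFun := fun x => mu ⟨x.1, x.2⟩
      map_add' := fun x y => mu.map_add ⟨x.1, x.2⟩ ⟨y.1, y.2⟩
      map_smul' := fun c x => mu.map_smul c ⟨x.1, x.2⟩ }
  obtain ⟨M, hM⟩ := LinearMap.exists_extend mu'
  refine ⟨M, LinearMap.ext fun x => ?_⟩
  exact LinearMap.congr_fun hM ⟨x.1, x.2⟩

/-- The functional `Y ↦ M (x Y y)`. -/
def sandwich (x y : R) (M : R →ₗ[F] F) : R →ₗ[F] F :=
  M ∘ₗ LinearMap.mulLeft F x ∘ₗ LinearMap.mulRight F y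

@[simp]
theorem sandwich_apply (x y : R) (M : R →ₗ[F] F) (Y : R) :
    sandwich x y M Y = M (x * (Y * y)) := rfl

theorem coAct_rstr {J : NonUnitalSubalgebra F R} (x : algGroup F R J) (M : R →ₗ[F] F) :
    coAct x (rstr J M) = rstr J (sandwich ((x : Rˣ) : R) ((x⁻¹ : Rˣ) : R) M) := rfl

theorem coAct_mul {J : NonUnitalSubalgebra F R} (g k : algGroup F R J) (mu : J →ₗ[F] F) :
    coAct (g * k) mu = coAct k (coAct g mu) := by
  obtain ⟨M, rfl⟩ := exists_rstr J mu
  refine LinearMap.ext fun X => ?_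
  simp only [coAct_rstr, rstr_apply, sandwich_apply]
  simp [mul_assoc]

theorem coOrbit_coAct {J : NonUnitalSubalgebra F R} (x : algGroup F R J) (mu : J →ₗ[F] F) :
    coOrbit J (coAct x mu) = coOrbit J mu := by
  ext nu
  constructor
  · rintro ⟨g, rfl⟩
    exact ⟨x * g, coAct_mul x g mu⟩
  · rintro ⟨g, rfl⟩
    refine ⟨x⁻¹ * g, ?_⟩
    change coAct (x⁻¹ * g) (coAct x mu) = coAct g mu
    rw [← coAct_mul, mul_inv_cancel_left]

theorem kirillov_coAct (θ : AddChar F ℂ) {J : NonUnitalSubalgebra F R} (x : algGroup F R J)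
    (mu : J →ₗ[F] F) : kirillov θ J (coAct x mu) = kirillov θ J mu := by
  unfold kirillov
  rw [coOrbit_coAct]

theorem coOrbit_eq_range (J : NonUnitalSubalgebra F R) (mu : J →ₗ[F] F) :
    coOrbit J mu = Set.range fun g : algGroup F R J => coAct g⁻¹ mu := by
  ext nu
  constructor
  · rintro ⟨g, rfl⟩; exact ⟨g⁻¹, by simp⟩
  · rintro ⟨g, rfl⟩; exact ⟨g⁻¹, rfl⟩

/-- A Kirillov function is a positive multiple of an average over the group. -/
theorem exists_kirillov_eq (θ : AddChar F ℂ) (J : NonUnitalSubalgebra F R) (M : R →ₗ[F] F) :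
    ∃ c : ℝ, 0 < c ∧ ∀ g : algGroup F R J, kirillov θ J (rstr J M) g =
      c * ∑ x : algGroup F R J,
        θ (M (((x : Rˣ) : R) * (((g : Rˣ) : R) - 1) * (((x : Rˣ)⁻¹ : Rˣ) : R))) := by
  set n := Nat.card (coOrbit J (rstr J M)) with hn
  have hn0 : 0 < n := by
    have : Nonempty (coOrbit J (rstr J M)) := ⟨⟨_, ⟨1, rfl⟩⟩⟩
    have : Finite (coOrbit J (rstr J M)) := Set.finite_range _
    exact Nat.card_pos
  have hn0' : (0 : ℝ) < n := by exact_mod_cast hn0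
  have hG : 0 < Nat.card (algGroup F R J) := Nat.card_pos
  refine ⟨(Real.sqrt n)⁻¹ * (n / Nat.card (algGroup F R J)), by positivity, fun g => ?_⟩
  unfold kirillov
  rw [← hn]
  rw [coOrbit_eq_range] at hn ⊢
  rw [finsum_range_eq _ _ fun mu => thetaFn θ J mu g, ← hn]
  · push_cast
    rw [mul_assoc]
    congr 2
    refine Fintype.sum_equiv (Equiv.inv _) _ _ fun x => ?_
    simp [thetaFn, coAct_rstr, gElt, mul_assoc]
  · intro g h e k
    change coAct g⁻¹ _ = coAct h⁻¹ _ at e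
    simp only [mul_inv_rev, coAct_mul]
    rw [e]

theorem kirillov_isClassFun (θ : AddChar F ℂ) (J : NonUnitalSubalgebra F R) (mu : J →ₗ[F] F) :
    IsClassFun (kirillov θ J mu) := by
  obtain ⟨M, rfl⟩ := exists_rstr J mu
  obtain ⟨c, -, hc⟩ := exists_kirillov_eq θ J M
  intro g y
  rw [hc, hc]
  congr 1
  refine Fintype.sum_equiv (Equiv.mulRight y) _ _ fun x => ?_
  congr 2
  have : (((y * g * y⁻¹ : algGroup F R J) : Rˣ) : R) - 1 =
      ((y : Rˣ) : R) * (((g : Rˣ) : R) - 1) * (((y : Rˣ)⁻¹ : Rˣ) : R) := by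
    simp [mul_sub, sub_mul]
  rw [this]
  simp [mul_assoc]

/-- Kirillov functions have norm one. -/
theorem innerG_kirillov {θ : AddChar F ℂ} (hθ : θ ≠ 1) {J : NonUnitalSubalgebra F R}
    (hJ : IsNil J) (mu : J →ₗ[F] F) :
    innerG (algGroup F R J) (kirillov θ J mu) (kirillov θ J mu) = 1 := by
  have hfin : (coOrbit J mu).Finite := Set.finite_range _
  set O := hfin.toFinset with hO
  have hcard : Nat.card (coOrbit J mu) = O.card := Nat.card_eq_card_finite_toFinset hfin
  have hO0 : 0 < O.card := Finset.card_pos.mpr ⟨coAct 1 mu, hfin.mem_toFinset.mpr ⟨1, rfl⟩⟩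
  have hk : kirillov θ J mu = fun g => ((Real.sqrt O.card : ℂ))⁻¹ *
      ∑ nu ∈ O, thetaFn θ J nu g := by
    funext g
    unfold kirillov
    rw [hcard, finsum_mem_eq_finite_toFinset_sum _ hfin]
  have horth : ∀ nu nu' : J →ₗ[F] F, ∑ g : algGroup F R J,
      thetaFn θ J nu g * (starRingEnd ℂ) (thetaFn θ J nu' g) =
        if nu = nu' then (Nat.card (algGroup F R J) : ℂ) else 0 := by
    intro nu nu'
    have h1 : ∀ g : algGroup F R J, thetaFn θ J nu g * (starRingEnd ℂ) (thetaFn θ J nu' g) =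
        θ ((nu - nu') (gElt g)) := fun g => by
      rw [thetaFn, thetaFn, theta_conj, ← AddChar.map_add_eq_mul, LinearMap.sub_apply,
        sub_eq_add_neg]
    rw [Finset.sum_congr rfl fun g _ => h1 g, sum_gElt hJ fun X => θ ((nu - nu') X),
      sum_theta hθ, card_algGroup hJ]
    simp only [sub_eq_zero]
  rw [hk, innerG_smul_self, innerG_eq_sum]
  have h2 : ∑ g : algGroup F R J, (∑ nu ∈ O, thetaFn θ J nu g) *
      (starRingEnd ℂ) (∑ nu ∈ O, thetaFn θ J nu g) =
      ∑ nu ∈ O, ∑ nu' ∈ O, ∑ g : algGroup F R J,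
        thetaFn θ J nu g * (starRingEnd ℂ) (thetaFn θ J nu' g) := by
    simp only [map_sum, Finset.sum_mul_sum]
    rw [Finset.sum_comm]
    exact Finset.sum_congr rfl fun nu _ => Finset.sum_comm
  rw [h2]
  simp only [horth, Finset.sum_ite_eq, Finset.sum_ite_mem, Finset.inter_self, Finset.sum_const,
    nsmul_eq_mul, map_inv₀, Complex.conj_ofReal]
  have h3 := card_ne_zero' (G := algGroup F R J)
  have h4 : ((Real.sqrt O.card : ℂ)) * (Real.sqrt O.card : ℂ) = O.card := by
    rw [← Complex.ofReal_mul, Real.mul_self_sqrt (by positivity)]; simp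
  have h5 : (O.card : ℂ) ≠ 0 := by exact_mod_cast hO0.ne'
  rw [← mul_inv, h4]
  field_simp

/-- A supercharacter is a positive multiple of an average over two copies of the group. -/
theorem exists_superchar_eq (θ : AddChar F ℂ) (J : NonUnitalSubalgebra F R) (M : R →ₗ[F] F) :
    ∃ c : ℝ, 0 < c ∧ ∀ g : algGroup F R J, superchar θ J (rstr J M) g =
      c * ∑ x : algGroup F R J, ∑ y : algGroup F R J,
        θ (M (((x : Rˣ) : R) * (((g : Rˣ) : R) - 1) * ((y : Rˣ) : R))) := by
  have hrange : twoOrbit J (rstr J M) = Set.range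
      fun p : algGroup F R J × algGroup F R J => leftAct p.1 (rightAct p.2⁻¹ (rstr J M)) := by
    ext nu
    constructor
    · rintro ⟨g, h, rfl⟩; exact ⟨(g, h⁻¹), by simp⟩
    · rintro ⟨⟨g, h⟩, rfl⟩; exact ⟨g, h⁻¹, rfl⟩
  have hact : ∀ p : algGroup F R J × algGroup F R J, leftAct p.1 (rightAct p.2⁻¹ (rstr J M)) =
      rstr J (sandwich (((p.1 : Rˣ)⁻¹ : Rˣ) : R) ((p.2 : Rˣ) : R) M) := fun p => by
    refine LinearMap.ext fun X => ?_
    have h : rightAct p.2⁻¹ (rstr J M) = rstr J (sandwich 1 ((p.2 : Rˣ) : R) M) :=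
      LinearMap.ext fun Y => by simp [rightAct, rmulMap]
    rw [h]
    simp [leftAct, lmulMap, mul_assoc]
  set n := Nat.card (twoOrbit J (rstr J M)) with hn
  have hfin : Finite (twoOrbit J (rstr J M)) := by
    rw [hrange]; exact Set.finite_range _
  have hn0 : 0 < n := by
    have : Nonempty (twoOrbit J (rstr J M)) := ⟨⟨_, ⟨1, 1, rfl⟩⟩⟩
    exact Nat.card_pos
  have hl0 : 0 < Nat.card (leftOrbit J (rstr J M)) := by
    have : Nonempty (leftOrbit J (rstr J M)) := ⟨⟨_, ⟨1, rfl⟩⟩⟩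
    have : Finite (leftOrbit J (rstr J M)) := Set.finite_range _
    exact Nat.card_pos
  have hG : 0 < Nat.card (algGroup F R J × algGroup F R J) := Nat.card_pos
  refine ⟨Nat.card (leftOrbit J (rstr J M)) / n *
    (n / Nat.card (algGroup F R J × algGroup F R J)), by positivity, fun g => ?_⟩
  unfold superchar
  rw [← hn]
  rw [hrange] at hn ⊢
  rw [finsum_range_eq _ _ fun mu => thetaFn θ J mu g, ← hn]
  · push_cast
    rw [mul_assoc]
    congr 2
    rw [← Fintype.sum_prod_type' fun (x y : algGroup F R J) =>
      θ (M (((x : Rˣ) : R) * (((g : Rˣ) : R) - 1) * ((y : Rˣ) : R)))]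
    refine Fintype.sum_equiv (Equiv.prodCongr (Equiv.inv _) (Equiv.refl _)) _ _ fun x => ?_
    simp [thetaFn, hact, gElt, mul_assoc]
  · intro g h e k
    simp only [hact] at e ⊢
    refine LinearMap.ext fun X => ?_
    have hX : (((k.1 : Rˣ)⁻¹ : Rˣ) : R) * X * ((k.2 : Rˣ) : R) ∈ J :=
      mul_unit_mem k.2 (unit_mul_mem k.1⁻¹ X.2)
    have := LinearMap.congr_fun e ⟨_, hX⟩
    simp only [rstr_apply, sandwich_apply] at this ⊢
    simpa [mul_assoc] using this

end Algebra

section Mackey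

variable {J : NonUnitalSubalgebra F R} {Λ : R →ₗ[F] F}

/-! ### The subalgebras attached to a functional on `R` -/

theorem lamE_rstr {x : R} (hx : x ∈ J) : lamE J (rstr J Λ) x = Λ x :=
  lamE_apply J _ hx

theorem mem_lone_iff {x : R} :
    x ∈ lone J (rstr J Λ) ↔ x ∈ J ∧ ∀ y ∈ J, Λ (x * y) = 0 :=
  and_congr_right fun hx => forall₂_congr fun y hy => by
    rw [lamE_rstr (J.mul_mem hx hy)]

theorem mem_sone_iff {x : R} :
    x ∈ sone J (rstr J Λ) ↔ x ∈ J ∧ ∀ y ∈ lone J (rstr J Λ), Λ (x * y) = 0 :=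
  and_congr_right fun hx => forall₂_congr fun y hy => by
    rw [lamE_rstr (J.mul_mem hx (lone_le J _ hy))]

theorem apply_eq_zero_of_mem_kone {x : R} (hx : x ∈ kone J (rstr J Λ)) : Λ x = 0 := by
  rw [← lamE_rstr (lone_le J _ hx.1)]; exact hx.2

theorem lone_le_sone : lone J (rstr J Λ) ≤ sone J (rstr J Λ) := fun _ hx =>
  mem_sone_iff.mpr ⟨lone_le J _ hx, fun y hy => (mem_lone_iff.mp hx).2 y (lone_le J _ hy)⟩

theorem lone_mul_unit {y : R} (hy : y ∈ lone J (rstr J Λ)) (g : algGroup F R J) :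
    y * ((g : Rˣ) : R) ∈ lone J (rstr J Λ) := by
  have h : y * ((g : Rˣ) : R) = y * (((g : Rˣ) : R) - 1) + y := by noncomm_ring
  rw [h]
  exact add_mem (lone_mul_mem J _ hy g.2.1) hy

theorem apply_lone_mul_unit {y : R} (hy : y ∈ lone J (rstr J Λ)) (g : algGroup F R J) :
    Λ (y * ((g : Rˣ) : R)) = Λ y := by
  have h : y * ((g : Rˣ) : R) = y * (((g : Rˣ) : R) - 1) + y := by noncomm_ring
  rw [h, map_add, (mem_lone_iff.mp hy).2 _ g.2.1, zero_add]

/-- A functional killing `𝔩_λ` has the form `X ↦ λ(XA)` on `J`. -/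
theorem exists_right_mul {M : R →ₗ[F] F} (hM : ∀ X ∈ lone J (rstr J Λ), M X = 0) :
    ∃ A ∈ J, ∀ X ∈ J, M X = Λ (X * A) := by
  let V := J.toSubmodule
  let Φ : V →ₗ[F] Module.Dual F V :=
    { toFun := fun A => (Λ ∘ₗ LinearMap.mulRight F (A : R)).domRestrict V
      map_add' := fun A B => by ext X; simp [mul_add]
      map_smul' := fun c A => by ext X; simp }
  have hfin : FiniteDimensional F V := Module.Finite.of_finite
  have h1 : M.domRestrict V ∈ (LinearMap.range Φ).dualCoannihilator.dualAnnihilator := by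
    rw [Submodule.mem_dualAnnihilator]
    rintro ⟨X, hX⟩ hXW
    rw [Submodule.mem_dualCoannihilator] at hXW
    exact hM X (mem_lone_iff.mpr ⟨hX, fun y hy => hXW _ ⟨⟨y, hy⟩, rfl⟩⟩)
  rw [Subspace.dualCoannihilator_dualAnnihilator_eq] at h1
  obtain ⟨⟨A, hA⟩, h2⟩ := h1
  exact ⟨A, hA, fun X hX => (LinearMap.congr_fun h2 ⟨X, hX⟩).symm⟩

/-- A functional agreeing with `λ` on `𝔩_λ` is a translate of `λ`. -/
theorem exists_right_translate (hJ : IsNil J) {M : R →ₗ[F] F}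
    (hM : ∀ X ∈ lone J (rstr J Λ), M X = Λ X) :
    ∃ u : algGroup F R J, ∀ X ∈ J, M X = Λ (X * ((u : Rˣ) : R)) := by
  obtain ⟨A, hA, h⟩ := exists_right_mul (J := J) (Λ := Λ) (M := M - Λ)
    fun X hX => by simp [hM X hX]
  obtain ⟨u, hu⟩ := exists_algGroup_sub_one hJ hA
  refine ⟨u, fun X hX => ?_⟩
  have h1 := h X hX
  rw [← hu, mul_sub, map_sub, mul_one, LinearMap.sub_apply] at h1
  linear_combination h1

/-- If `θ_λ` does not distinguish elements of `𝔩_λ ∩ x⁻¹ 𝔩_λ` from their left translates by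
`x`, then `x` belongs to `1 + 𝔰_λ`. -/
theorem sub_one_mem_sone (hJ : IsNil J) {θ : AddChar F ℂ} (hθ : θ ≠ 1) (x : algGroup F R J)
    (h : ∀ Z ∈ lone J (rstr J Λ), ((x : Rˣ) : R) * Z ∈ lone J (rstr J Λ) →
      θ (Λ Z) = θ (Λ (((x : Rˣ) : R) * Z))) : ((x : Rˣ) : R) - 1 ∈ sone J (rstr J Λ) := by
  set X : R := ((x : Rˣ) : R) with hXdef
  set X' : R := (((x⁻¹ : algGroup F R J) : Rˣ) : R) with hX'def
  have hXX' : X * X' = 1 := by simp [hXdef, hX'def]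
  have hX'X : X' * X = 1 := by simp [hXdef, hX'def]
  let P := (lone J (rstr J Λ)).toSubmodule
  let Q := P.comap (LinearMap.mulLeft F X)
  have hPQ : Λ - Λ ∘ₗ LinearMap.mulLeft F X ∈ (P ⊓ Q).dualAnnihilator := by
    rw [Submodule.mem_dualAnnihilator]
    by_contra! hcon
    obtain ⟨Z₀, hZ₀, hne⟩ := hcon
    obtain ⟨⟨Z, hZ⟩, hZ1⟩ := exists_theta_ne_one hθ
      (l := (Λ - Λ ∘ₗ LinearMap.mulLeft F X).domRestrict (P ⊓ Q))
      (fun h0 => hne (LinearMap.congr_fun h0 ⟨Z₀, hZ₀⟩))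
    apply hZ1
    have h2 := h Z hZ.1 hZ.2
    change θ (Λ Z - Λ (X * Z)) = 1
    rw [AddChar.map_sub_eq_div, h2, div_self]
    exact (θ.val_isUnit _).ne_zero
  rw [Subspace.dualAnnihilator_inf_eq, Submodule.mem_sup] at hPQ
  obtain ⟨α, hα, β, hβ, hαβ⟩ := hPQ
  rw [Submodule.mem_dualAnnihilator] at hα hβ
  obtain ⟨A, hA, hA'⟩ := exists_right_mul (J := J) (Λ := Λ) (M := α) hα
  obtain ⟨B, hB, hB'⟩ := exists_right_mul (J := J) (Λ := Λ) (M := β ∘ₗ LinearMap.mulLeft F X')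
    fun Y hY => hβ _ (show X * (X' * Y) ∈ P by rwa [← mul_assoc, hXX', one_mul])
  obtain ⟨b, hb⟩ := exists_algGroup_sub_one hJ hB
  refine mem_sone_iff.mpr ⟨x.2.1, fun Z hZ => ?_⟩
  set Y : R := Z * (((b⁻¹ : algGroup F R J) : Rˣ) : R) with hY
  have hYl : Y ∈ lone J (rstr J Λ) := lone_mul_unit hZ b⁻¹
  have hYZ : Y * ((b : Rˣ) : R) = Z := by simp [hY, mul_assoc]
  have h1 : Λ Y = Λ Z := apply_lone_mul_unit hZ b⁻¹
  have h2 := LinearMap.congr_fun hαβ Y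
  simp only [LinearMap.add_apply, LinearMap.sub_apply, LinearMap.comp_apply,
    LinearMap.mulLeft_apply] at h2
  have h3 : α Y = 0 := by
    rw [hA' Y (lone_le J _ hYl)]; exact (mem_lone_iff.mp hYl).2 A hA
  have h4 := hB' (X * Y) (unit_mul_mem x (lone_le J _ hYl))
  simp only [LinearMap.comp_apply, LinearMap.mulLeft_apply] at h4
  rw [← mul_assoc X', hX'X, one_mul, ← hb, mul_sub, mul_one, map_sub, mul_assoc, hYZ] at h4
  rw [sub_mul, one_mul, map_sub]
  linear_combination h1 + h2 - h3 - h4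

/-! ### The Mackey datum -/

theorem thetaFn_rstr (θ : AddChar F ℂ) (a : NonUnitalSubalgebra F R) (M : R →ₗ[F] F)
    (g : algGroup F R a) : thetaFn θ a (rstr a M) g = θ (M (((g : Rˣ) : R) - 1)) := rfl

/-- The inclusion of `S_λ` into `G`. -/
def soneIncl (J : NonUnitalSubalgebra F R) (lam : J →ₗ[F] F) :
    algGroup F R (sone J lam) →* algGroup F R J :=
  Subgroup.inclusion (algGroup_mono (sone_le J lam))

@[simp]
theorem coe_soneIncl (lam : J →ₗ[F] F) (s : algGroup F R (sone J lam)) :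
    (soneIncl J lam s : Rˣ) = s := rfl

theorem mem_LgrpIn_iff {lam : J →ₗ[F] F} {s : algGroup F R (sone J lam)} :
    s ∈ LgrpIn J lam ↔ ((s : Rˣ) : R) - 1 ∈ lone J lam :=
  ⟨fun h => (Subgroup.mem_subgroupOf.mp h).1,
    fun h => Subgroup.mem_subgroupOf.mpr (mem_algGroup_of_sub_one_mem h)⟩

theorem isStableLinear (θ : AddChar F ℂ) (J : NonUnitalSubalgebra F R) {Λ M : R →ₗ[F] F}
    (hM : ∀ X ∈ lone J (rstr J Λ), M X = Λ X) :
    IsStableLinear (LgrpIn J (rstr J Λ)) (thetaFn θ (sone J (rstr J Λ)) (rstr _ M)) := by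
  have hmul : ∀ z ∈ LgrpIn J (rstr J Λ), ∀ w ∈ LgrpIn J (rstr J Λ),
      thetaFn θ (sone J (rstr J Λ)) (rstr _ M) (z * w) =
        thetaFn θ (sone J (rstr J Λ)) (rstr _ M) z *
          thetaFn θ (sone J (rstr J Λ)) (rstr _ M) w := by
    intro z hz w hw
    rw [mem_LgrpIn_iff] at hz hw
    have h1 : (((z * w : algGroup F R (sone J (rstr J Λ))) : Rˣ) : R) - 1 =
        (((z : Rˣ) : R) - 1) * (((w : Rˣ) : R) - 1) + (((z : Rˣ) : R) - 1) +
          (((w : Rˣ) : R) - 1) := by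
      push_cast; noncomm_ring
    rw [thetaFn_rstr, thetaFn_rstr, thetaFn_rstr, ← AddChar.map_add_eq_mul, h1, map_add M, map_add M,
      hM _ (mul_mem hz hw), (mem_lone_iff.mp hz).2 _ (lone_le J _ hw), zero_add]
  have hone : thetaFn θ (sone J (rstr J Λ)) (rstr _ M) 1 = 1 := by simp [thetaFn_rstr]
  refine ⟨hone, hmul, fun z hz => ?_, fun z hz s => ?_⟩
  · have h1 := hmul z hz z⁻¹ (inv_mem hz)
    rw [mul_inv_cancel, hone] at h1
    have h2 : thetaFn θ (sone J (rstr J Λ)) (rstr _ M) z *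
        (starRingEnd ℂ) (thetaFn θ (sone J (rstr J Λ)) (rstr _ M) z) = 1 := by
      rw [thetaFn_rstr, theta_conj, ← AddChar.map_add_eq_mul, add_neg_cancel,
        AddChar.map_zero_eq_one]
    have h3 := left_ne_zero_of_mul_eq_one h2
    exact mul_left_cancel₀ h3 (h2.trans h1)
  · rw [mem_LgrpIn_iff] at hz
    have h1 : (((s * z * s⁻¹ : algGroup F R (sone J (rstr J Λ))) : Rˣ) : R) - 1 =
        (((s : Rˣ) : R) - 1) * ((((z : Rˣ) : R) - 1) * (((s : Rˣ)⁻¹ : Rˣ) : R)) +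
          (((z : Rˣ) : R) - 1) * (((s : Rˣ)⁻¹ : Rˣ) : R) := by
      have : ((s : Rˣ) : R) * (((s : Rˣ)⁻¹ : Rˣ) : R) = 1 := by simp
      push_cast
      calc ((s : Rˣ) : R) * ((z : Rˣ) : R) * (((s : Rˣ)⁻¹ : Rˣ) : R) - 1
          = ((s : Rˣ) : R) * ((z : Rˣ) : R) * (((s : Rˣ)⁻¹ : Rˣ) : R) -
            ((s : Rˣ) : R) * (((s : Rˣ)⁻¹ : Rˣ) : R) := by rw [this]
        _ = _ := by noncomm_ring
    have h2 := lone_mul_unit hz (soneIncl J _ s⁻¹)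
    have h3 := apply_lone_mul_unit hz (soneIncl J _ s⁻¹)
    have h4 := sone_mul_lone_mem J _ s.2.1 h2
    simp only [coe_soneIncl, InvMemClass.coe_inv] at h2 h3 h4
    rw [thetaFn_rstr, thetaFn_rstr, h1, map_add, hM _ h4, hM _ h2, h3,
      (mem_sone_iff.mp s.2.1).2 _ h2, zero_add, hM _ hz]

theorem isMackeyDatum {θ : AddChar F ℂ} (hθ : θ ≠ 1) (hJ : IsNil J) (Λ : R →ₗ[F] F) :
    IsMackeyDatum (soneIncl J (rstr J Λ)) (LgrpIn J (rstr J Λ))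
      (thetaFn θ (sone J (rstr J Λ)) (rstr _ Λ)) := by
  refine ⟨Subgroup.inclusion_injective _, isStableLinear θ J fun _ _ => rfl, fun x hx => ?_⟩
  by_contra! hcon
  apply hx
  have h1 : ((x : Rˣ) : R) - 1 ∈ sone J (rstr J Λ) := by
    refine sub_one_mem_sone hJ hθ x fun Z hZ hxZ => ?_
    have hxZ' := lone_mul_unit hxZ x⁻¹
    obtain ⟨z, hz⟩ := exists_algGroup_sub_one (hJ.mono (sone_le J _)) (lone_le_sone hZ)
    obtain ⟨w, hw⟩ := exists_algGroup_sub_one (hJ.mono (sone_le J _)) (lone_le_sone hxZ')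
    have h2 := hcon z (mem_LgrpIn_iff.mpr (by rwa [hz])) w (mem_LgrpIn_iff.mpr (by rwa [hw])) (by
      apply Subtype.ext
      apply Units.ext
      have : ((w : Rˣ) : R) = 1 + ((x : Rˣ) : R) * Z * (((x⁻¹ : algGroup F R J) : Rˣ) : R) := by
        rw [← hw]; abel
      simp only [coe_soneIncl, Subgroup.coe_mul, Units.val_mul, this, ← hz]
      simp [mul_sub, sub_mul])
    rw [thetaFn_rstr, thetaFn_rstr, hz, hw, apply_lone_mul_unit hxZ] at h2
    exact h2
  exact ⟨⟨x, mem_algGroup_of_sub_one_mem h1⟩, rfl⟩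

end Mackey

section Sums

variable {J : NonUnitalSubalgebra F R} {Λ : R →ₗ[F] F}

/-! ### Cardinalities of orbits -/

theorem leftAct_mul (g k : algGroup F R J) (mu : J →ₗ[F] F) :
    leftAct (g * k) mu = leftAct g (leftAct k mu) := by
  obtain ⟨M, rfl⟩ := exists_rstr J mu
  refine LinearMap.ext fun X => ?_
  change M ((((g * k)⁻¹ : algGroup F R J) : Rˣ) * (X : R)) =
    M ((((k⁻¹ : algGroup F R J) : Rˣ) : R) * ((((g⁻¹ : algGroup F R J) : Rˣ) : R) * X))
  simp [mul_assoc]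

theorem leftAct_rstr_apply (g : algGroup F R J) (M : R →ₗ[F] F) (X : J) :
    leftAct g (rstr J M) X = M ((((g⁻¹ : algGroup F R J) : Rˣ) : R) * X) := rfl

theorem rightAct_rstr_apply (g : algGroup F R J) (M : R →ₗ[F] F) (X : J) :
    rightAct g (rstr J M) X = M (X * (((g⁻¹ : algGroup F R J) : Rˣ) : R)) := rfl

theorem leftAct_eq_self {g : algGroup F R J}
    (h : leftAct g (rstr J Λ) = rstr J Λ) :
    (((g⁻¹ : algGroup F R J) : Rˣ) : R) - 1 ∈ lone J (rstr J Λ) :=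
  mem_lone_iff.mpr ⟨g.2.2, fun y hy => by
    have := LinearMap.congr_fun h ⟨y, hy⟩
    rw [leftAct_rstr_apply, rstr_apply] at this
    rw [sub_mul, one_mul, map_sub, this, sub_self]⟩

theorem leftAct_mem_rightOrbit_iff (hJ : IsNil J) (g : algGroup F R J) :
    leftAct g (rstr J Λ) ∈ rightOrbit J (rstr J Λ) ↔
      (((g⁻¹ : algGroup F R J) : Rˣ) : R) - 1 ∈ sone J (rstr J Λ) := by
  constructor
  · rintro ⟨k, hk⟩
    refine mem_sone_iff.mpr ⟨g.2.2, fun y hy => ?_⟩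
    have h1 := LinearMap.congr_fun hk ⟨y, lone_le J _ hy⟩
    rw [leftAct_rstr_apply, rightAct_rstr_apply, apply_lone_mul_unit hy] at h1
    rw [sub_mul, one_mul, map_sub, ← h1, sub_self]
  · intro h
    obtain ⟨u, hu⟩ := exists_right_translate hJ (Λ := Λ)
      (M := Λ ∘ₗ LinearMap.mulLeft F (((g⁻¹ : algGroup F R J) : Rˣ) : R)) fun X hX => by
        have := (mem_sone_iff.mp h).2 X hX
        rw [sub_mul, one_mul, map_sub, sub_eq_zero] at this
        exact this
    refine ⟨u⁻¹, LinearMap.ext fun X => ?_⟩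
    change rightAct u⁻¹ (rstr J Λ) X = _
    rw [leftAct_rstr_apply, rightAct_rstr_apply, inv_inv]
    exact (hu X X.2).symm

theorem leftOrbit_inter_rightOrbit (hJ : IsNil J) :
    leftOrbit J (rstr J Λ) ∩ rightOrbit J (rstr J Λ) =
      Set.range fun s => leftAct (soneIncl J (rstr J Λ) s) (rstr J Λ) := by
  ext mu
  constructor
  · rintro ⟨⟨g, rfl⟩, h⟩
    have h1 := mem_algGroup_of_sub_one_mem ((leftAct_mem_rightOrbit_iff hJ g).mp h)
    exact ⟨⟨g, by simpa using inv_mem h1⟩, rfl⟩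
  · rintro ⟨s, rfl⟩
    exact ⟨⟨_, rfl⟩, (leftAct_mem_rightOrbit_iff hJ _).mpr (s⁻¹).2.1⟩

theorem card_orbit_ratio (hJ : IsNil J) (Λ : R →ₗ[F] F) :
    (Nat.card (leftOrbit J (rstr J Λ) ∩ rightOrbit J (rstr J Λ) : Set (J →ₗ[F] F)) : ℂ) /
      Nat.card (leftOrbit J (rstr J Λ)) =
    (Nat.card (algGroup F R (sone J (rstr J Λ))) : ℂ) / Nat.card (algGroup F R J) := by
  set n := Nat.card {g : algGroup F R J // leftAct g (rstr J Λ) = leftAct 1 (rstr J Λ)} with hn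
  have h1 : Nat.card (algGroup F R J) = Nat.card (leftOrbit J (rstr J Λ)) * n := by
    rw [card_eq_range_mul_fiber (fun g : algGroup F R J => leftAct g (rstr J Λ))
      fun g k e l => by simp only [leftAct_mul] at e ⊢; rw [e]]
    congr 1
    rw [hn, Nat.card_eq_fintype_card, Fintype.card_subtype]
    congr!
  have h2 : Nat.card (algGroup F R (sone J (rstr J Λ))) =
      Nat.card (leftOrbit J (rstr J Λ) ∩ rightOrbit J (rstr J Λ) : Set (J →ₗ[F] F)) * n := by
    rw [card_eq_range_mul_fiber (fun s => leftAct (soneIncl J (rstr J Λ) s) (rstr J Λ))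
      fun g k e l => by simp only [map_mul, leftAct_mul] at e ⊢; rw [e],
      leftOrbit_inter_rightOrbit hJ]
    congr 1
    rw [hn, Nat.card_eq_fintype_card, Fintype.card_subtype]
    refine Finset.card_nbij (soneIncl J (rstr J Λ)) ?_ ?_ ?_
    · intro s hs; simpa using hs
    · exact (Subgroup.inclusion_injective _).injOn
    · intro g hg
      have hg' := (Finset.mem_filter.mp hg).2
      have hone : leftAct 1 (rstr J Λ) = rstr J Λ := LinearMap.ext fun X => by
        rw [leftAct_rstr_apply]; simp
      have h4 := lone_le_sone (leftAct_eq_self (hg'.trans hone))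
      exact ⟨⟨g, by simpa using inv_mem (mem_algGroup_of_sub_one_mem h4)⟩,
        (@Finset.mem_filter _ _ (_) _ _).mpr ⟨Finset.mem_univ _, hg'⟩, rfl⟩
  have h0 := card_ne_zero' (G := algGroup F R J)
  rw [h1] at h0 ⊢
  rw [h2]
  push_cast at h0 ⊢
  have h5 := right_ne_zero_of_mul h0
  rw [mul_div_mul_right _ _ h5]

/-! ### Pairing with the supercharacter -/

theorem sum_theta_mul (hJ : IsNil J) {θ : AddChar F ℂ} (hθ : θ ≠ 1) {X : R} (hX : X ∈ J) :
    ∑ y : algGroup F R J, θ (Λ (X * ((y : Rˣ) : R))) =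
      if X ∈ lone J (rstr J Λ) then (Nat.card J : ℂ) * θ (Λ X) else 0 := by
  have h1 : ∀ y : algGroup F R J, θ (Λ (X * ((y : Rˣ) : R))) =
      θ (Λ X) * θ (rstr J (Λ ∘ₗ LinearMap.mulLeft F X) (gElt y)) := fun y => by
    rw [← AddChar.map_add_eq_mul]
    simp [gElt, mul_sub]
  have h2 : rstr J (Λ ∘ₗ LinearMap.mulLeft F X) = 0 ↔ X ∈ lone J (rstr J Λ) := by
    rw [mem_lone_iff]
    exact ⟨fun h => ⟨hX, fun y hy => LinearMap.congr_fun h ⟨y, hy⟩⟩,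
      fun h => LinearMap.ext fun y => h.2 y y.2⟩
  rw [Finset.sum_congr rfl fun y _ => h1 y, ← Finset.mul_sum,
    sum_gElt hJ fun Y => θ (rstr J (Λ ∘ₗ LinearMap.mulLeft F X) Y), sum_theta hθ]
  simp only [h2]
  split_ifs
  · ring
  · ring

theorem exists_innerG_superchar (hJ : IsNil J) {θ : AddChar F ℂ} (hθ : θ ≠ 1)
    (Λ : R →ₗ[F] F) :
    ∃ c : ℝ, 0 < c ∧ ∀ φ : algGroup F R J → ℂ, IsClassFun φ →
      innerG (algGroup F R J) (superchar θ J (rstr J Λ)) φ =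
        c * ∑ z : LgrpIn J (rstr J Λ), thetaFn θ (sone J (rstr J Λ)) (rstr _ Λ) z *
          (starRingEnd ℂ) (φ (soneIncl J (rstr J Λ) z)) := by
  obtain ⟨c, hc, h⟩ := exists_superchar_eq θ J Λ
  have hJ0 : 0 < Nat.card J := Nat.card_pos
  refine ⟨c * Nat.card J, by positivity, fun φ hφ => ?_⟩
  have h1 : ∀ x : algGroup F R J, (∑ g : algGroup F R J, (∑ y : algGroup F R J,
      θ (Λ (((x : Rˣ) : R) * (((g : Rˣ) : R) - 1) * ((y : Rˣ) : R)))) *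
        (starRingEnd ℂ) (φ g)) =
      ∑ g : algGroup F R J, (∑ y : algGroup F R J,
        θ (Λ ((((g : Rˣ) : R) - 1) * ((y : Rˣ) : R)))) * (starRingEnd ℂ) (φ g) := by
    intro x
    refine Fintype.sum_equiv (MulAut.conj x).toEquiv _ _ fun g => ?_
    rw [MulEquiv.toEquiv_eq_coe, EquivLike.coe_coe, MulAut.conj_apply, hφ]
    congr 1
    refine Fintype.sum_equiv (Equiv.mulLeft x) _ _ fun y => ?_
    congr 2
    simp [mul_sub, sub_mul, mul_assoc]
  have h2 : ∑ g : algGroup F R J, (∑ y : algGroup F R J,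
        θ (Λ ((((g : Rˣ) : R) - 1) * ((y : Rˣ) : R)))) * (starRingEnd ℂ) (φ g) =
      Nat.card J * ∑ z : LgrpIn J (rstr J Λ), thetaFn θ (sone J (rstr J Λ)) (rstr _ Λ) z *
          (starRingEnd ℂ) (φ (soneIncl J (rstr J Λ) z)) := by
    rw [Finset.mul_sum]
    symm
    refine Fintype.sum_of_injective
      (fun z : LgrpIn J (rstr J Λ) => soneIncl J (rstr J Λ) z) ?_ _ _ ?_ ?_
    · exact (Subgroup.inclusion_injective _).comp Subtype.val_injective
    · intro g hg
      rw [sum_theta_mul hJ hθ g.2.1, if_neg, zero_mul]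
      intro hgl
      exact hg ⟨⟨⟨g, mem_algGroup_of_sub_one_mem (lone_le_sone hgl)⟩, mem_LgrpIn_iff.mpr hgl⟩,
        rfl⟩
    · intro z
      rw [sum_theta_mul hJ hθ (soneIncl J _ _).2.1, coe_soneIncl,
        if_pos (mem_LgrpIn_iff.mp z.2), thetaFn_rstr, mul_assoc]
  have h3 := card_ne_zero' (G := algGroup F R J)
  rw [innerG_eq_sum]
  simp only [h, mul_assoc, ← Finset.mul_sum, Finset.sum_mul]
  rw [Finset.sum_comm]
  simp only [← Finset.sum_mul, ← mul_assoc]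
  simp only [h1, h2, Finset.sum_const, Finset.card_univ, nsmul_eq_mul]
  rw [Nat.card_eq_fintype_card] at h3 ⊢
  push_cast
  field_simp

/-! ### Kirillov functions lying over `θ_λ` -/

theorem exists_kirillov_eq_of_sum_ne_zero {θ : AddChar F ℂ} (hθ : θ ≠ 1)
    {l a : NonUnitalSubalgebra F R} (hl : IsNil l) (hla : l ≤ a) (Λ : R →ₗ[F] F)
    (nu : a →ₗ[F] F)
    (h : ∑ z : algGroup F R l, θ (Λ (((z : Rˣ) : R) - 1)) * (starRingEnd ℂ)
      (kirillov θ a nu (Subgroup.inclusion (algGroup_mono hla) z)) ≠ 0) :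
    ∃ M : R →ₗ[F] F, kirillov θ a (rstr a M) = kirillov θ a nu ∧ ∀ X ∈ l, M X = Λ X := by
  obtain ⟨M, rfl⟩ := exists_rstr a nu
  obtain ⟨c, -, hc⟩ := exists_kirillov_eq θ a M
  have h1 : ∀ (z : algGroup F R l) (x : algGroup F R a),
      θ (Λ (((z : Rˣ) : R) - 1)) * (starRingEnd ℂ)
        (θ (M (((x : Rˣ) : R) * (((z : Rˣ) : R) - 1) * (((x : Rˣ)⁻¹ : Rˣ) : R)))) =
      θ (rstr l (Λ - sandwich ((x : Rˣ) : R) (((x : Rˣ)⁻¹ : Rˣ) : R) M) (gElt z)) := by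
    intro z x
    rw [theta_conj, ← AddChar.map_add_eq_mul, ← sub_eq_add_neg]
    simp [gElt, mul_assoc]
  simp only [hc, map_mul, map_sum, Subgroup.coe_inclusion] at h
  simp only [mul_left_comm _ ((starRingEnd ℂ) (c : ℂ)), Finset.mul_sum, h1] at h
  rw [Finset.sum_comm] at h
  obtain ⟨x, -, hx⟩ := Finset.exists_ne_zero_of_sum_ne_zero h
  rw [← Finset.mul_sum, sum_gElt hl fun Z =>
    θ (rstr l (Λ - sandwich ((x : Rˣ) : R) (((x : Rˣ)⁻¹ : Rˣ) : R) M) Z), sum_theta hθ] at hx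
  have h2 : rstr l (Λ - sandwich ((x : Rˣ) : R) (((x : Rˣ)⁻¹ : Rˣ) : R) M) = 0 := by
    by_contra h0
    rw [if_neg h0, mul_zero] at hx
    exact hx rfl
  refine ⟨sandwich ((x : Rˣ) : R) (((x : Rˣ)⁻¹ : Rˣ) : R) M, ?_, fun X hX => ?_⟩
  · rw [← coAct_rstr, kirillov_coAct]
  · exact (sub_eq_zero.mp (LinearMap.congr_fun h2 ⟨X, hX⟩)).symm

theorem sum_LgrpIn (lam : J →ₗ[F] F) (Φ : algGroup F R (lone J lam) → ℂ) :
    ∑ z : LgrpIn J lam, Φ ⟨((z : algGroup F R (sone J lam)) : Rˣ), z.2⟩ = ∑ z, Φ z := by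
  refine Fintype.sum_bijective (fun z : LgrpIn J lam =>
    (⟨((z : algGroup F R (sone J lam)) : Rˣ), z.2⟩ : algGroup F R (lone J lam)))
    ⟨fun z w e => ?_, fun z => ?_⟩ _ _ fun _ => rfl
  · have := congrArg (fun u : algGroup F R (lone J lam) => (u : Rˣ)) e
    exact Subtype.ext (Subtype.ext this)
  · obtain ⟨M, rfl⟩ := exists_rstr J lam
    exact ⟨⟨⟨z, algGroup_mono lone_le_sone z.2⟩, z.2⟩, rfl⟩

theorem kirillov_mul {θ : AddChar F ℂ} {M : R →ₗ[F] F}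
    (hM : ∀ X ∈ lone J (rstr J Λ), M X = Λ X)
    (s z : algGroup F R (sone J (rstr J Λ))) (hz : z ∈ LgrpIn J (rstr J Λ)) :
    kirillov θ (sone J (rstr J Λ)) (rstr _ M) (s * z) =
      kirillov θ (sone J (rstr J Λ)) (rstr _ M) s *
        thetaFn θ (sone J (rstr J Λ)) (rstr _ Λ) z := by
  obtain ⟨c, -, hc⟩ := exists_kirillov_eq θ (sone J (rstr J Λ)) M
  rw [hc, hc, mul_assoc, Finset.sum_mul]
  congr 1
  refine Finset.sum_congr rfl fun x _ => ?_
  have hxz : x * z * x⁻¹ ∈ LgrpIn J (rstr J Λ) := (LgrpIn_normal J _).conj_mem z hz x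
  have h1 := (isStableLinear θ J hM).invariant z hz x
  rw [mem_LgrpIn_iff] at hz hxz
  have h2 : ((x : Rˣ) : R) * ((((s * z : algGroup F R (sone J (rstr J Λ))) : Rˣ) : R) - 1) *
      (((x : Rˣ)⁻¹ : Rˣ) : R) =
      ((x : Rˣ) : R) * (((s : Rˣ) : R) - 1) * (((x : Rˣ)⁻¹ : Rˣ) : R) +
      ((((x * s * x⁻¹ : algGroup F R (sone J (rstr J Λ))) : Rˣ) : R) - 1) *
        ((((x * z * x⁻¹ : algGroup F R (sone J (rstr J Λ))) : Rˣ) : R) - 1) +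
      ((((x * z * x⁻¹ : algGroup F R (sone J (rstr J Λ))) : Rˣ) : R) - 1) := by
    simp [mul_sub, sub_mul, mul_assoc]
  have h3 := sone_mul_lone_mem J _ (x * s * x⁻¹).2.1 hxz
  have h4 := (mem_sone_iff.mp (x * s * x⁻¹).2.1).2 _ hxz
  rw [h2, map_add M, map_add M, hM _ h3, h4, add_zero, AddChar.map_add_eq_mul]
  congr 1
  rw [thetaFn_rstr, thetaFn_rstr, hM _ hz] at h1
  rw [h1, thetaFn_rstr]

end Sums

section Induction

variable {J : NonUnitalSubalgebra F R} {Λ : R →ₗ[F] F}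

/-! ### Induced Kirillov functions -/

/-- Averaging `θ_M` over conjugation by `L_λ` cuts it off to `S_λ`. -/
theorem sum_lone_conj (hJ : IsNil J) {θ : AddChar F ℂ} (hθ : θ ≠ 1) {M : R →ₗ[F] F}
    (hM : ∀ X ∈ lone J (rstr J Λ), M X = Λ X) {Y : R} (hY : Y ∈ J) :
    ∑ z : algGroup F R (lone J (rstr J Λ)),
      θ (M (((z : Rˣ) : R) * Y * (((z : Rˣ)⁻¹ : Rˣ) : R))) =
    Nat.card (lone J (rstr J Λ)) * if Y ∈ sone J (rstr J Λ) then θ (M Y) else 0 := by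
  obtain ⟨u, hu⟩ := exists_right_translate hJ hM
  have h1 : ∀ z : algGroup F R (lone J (rstr J Λ)),
      θ (M (((z : Rˣ) : R) * Y * (((z : Rˣ)⁻¹ : Rˣ) : R))) =
        θ (M Y) * θ (rstr (lone J (rstr J Λ)) (M ∘ₗ LinearMap.mulLeft F Y) (gElt z⁻¹)) := by
    intro z
    have hz : ((z : Rˣ) : R) - 1 ∈ lone J (rstr J Λ) := z.2.1
    have hz' : (((z : Rˣ)⁻¹ : Rˣ) : R) - 1 ∈ J := lone_le J _ z.2.2
    have h2 : ((z : Rˣ) : R) * Y * (((z : Rˣ)⁻¹ : Rˣ) : R) =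
        Y + Y * ((((z : Rˣ)⁻¹ : Rˣ) : R) - 1) +
          ((((z : Rˣ) : R) - 1) * (Y * ((((z : Rˣ)⁻¹ : Rˣ) : R) - 1)) +
            (((z : Rˣ) : R) - 1) * Y) := by noncomm_ring
    have h3 : ∀ W ∈ J, M ((((z : Rˣ) : R) - 1) * W) = 0 := fun W hW => by
      rw [hM _ (lone_mul_mem J _ hz hW)]
      exact (mem_lone_iff.mp hz).2 W hW
    rw [← AddChar.map_add_eq_mul, h2, map_add M, map_add M, map_add M,
      h3 _ (J.mul_mem hY hz'), h3 _ hY, add_zero, add_zero]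
    rfl
  have h2 : rstr (lone J (rstr J Λ)) (M ∘ₗ LinearMap.mulLeft F Y) = 0 ↔
      Y ∈ sone J (rstr J Λ) := by
    rw [mem_sone_iff]
    constructor
    · refine fun h => ⟨hY, fun y hy => ?_⟩
      have h3 := LinearMap.congr_fun h ⟨_, lone_mul_unit hy u⁻¹⟩
      simp only [rstr_apply, LinearMap.comp_apply, LinearMap.mulLeft_apply,
        LinearMap.zero_apply] at h3
      rw [hu _ (J.mul_mem hY (lone_le J _ (lone_mul_unit hy u⁻¹)))] at h3
      simpa [mul_assoc] using h3
    · rintro ⟨-, h⟩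
      refine LinearMap.ext fun y => ?_
      simp only [rstr_apply, LinearMap.comp_apply, LinearMap.mulLeft_apply,
        LinearMap.zero_apply]
      rw [hu _ (J.mul_mem hY (lone_le J _ y.2)), mul_assoc]
      exact h _ (lone_mul_unit y.2 u)
  have hnil : IsNil (lone J (rstr J Λ)) := hJ.mono (lone_le J _)
  have h5 : ∑ z : algGroup F R (lone J (rstr J Λ)),
      θ (rstr (lone J (rstr J Λ)) (M ∘ₗ LinearMap.mulLeft F Y) (gElt z⁻¹)) =
      ∑ z : algGroup F R (lone J (rstr J Λ)),
        θ (rstr (lone J (rstr J Λ)) (M ∘ₗ LinearMap.mulLeft F Y) (gElt z)) :=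
    Fintype.sum_equiv (Equiv.inv _) _ _ fun z => rfl
  rw [Finset.sum_congr rfl fun z _ => h1 z, ← Finset.mul_sum, h5,
    sum_gElt hnil fun Z => θ (rstr (lone J (rstr J Λ)) (M ∘ₗ LinearMap.mulLeft F Y) Z),
    sum_theta hθ]
  simp only [h2]
  split_ifs
  · ring
  · ring

theorem sum_soneIncl_eq (θ : AddChar F ℂ) (M : R →ₗ[F] F) (lam : J →ₗ[F] F)
    (y : algGroup F R J) :
    ∑ h : algGroup F R (sone J lam),
      (if soneIncl J lam h = y then θ (M (((h : Rˣ) : R) - 1)) else 0) =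
    if ((y : Rˣ) : R) - 1 ∈ sone J lam then θ (M (((y : Rˣ) : R) - 1)) else 0 := by
  split_ifs with hy
  · rw [Finset.sum_eq_single ⟨(y : Rˣ), mem_algGroup_of_sub_one_mem hy⟩]
    · exact if_pos rfl
    · intro h _ hne
      rw [if_neg]
      rintro rfl
      exact hne rfl
    · intro h; exact absurd (Finset.mem_univ _) h
  · refine Finset.sum_eq_zero fun h _ => if_neg ?_
    rintro rfl
    exact hy h.2.1

/-- Inducing the Kirillov function of `S_λ` attached to a functional that agrees with `λ` on
`𝔩_λ` gives the Kirillov function of `G` attached to the same functional. -/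
theorem indHom_kirillov (hJ : IsNil J) {θ : AddChar F ℂ} (hθ : θ ≠ 1) {M : R →ₗ[F] F}
    (hM : ∀ X ∈ lone J (rstr J Λ), M X = Λ X) :
    indHom (soneIncl J (rstr J Λ)) (kirillov θ (sone J (rstr J Λ)) (rstr _ M)) =
      kirillov θ J (rstr J M) := by
  obtain ⟨c, hc0, hc⟩ := exists_kirillov_eq θ J M
  obtain ⟨d, hd0, hd⟩ := exists_kirillov_eq θ (sone J (rstr J Λ)) M
  set ι := soneIncl J (rstr J Λ) with hι
  let D : algGroup F R J → ℂ := fun y =>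
    if ((y : Rˣ) : R) - 1 ∈ sone J (rstr J Λ) then θ (M (((y : Rˣ) : R) - 1)) else 0
  have hL0 : (Nat.card (lone J (rstr J Λ)) : ℂ) ≠ 0 := by
    have : 0 < Nat.card (lone J (rstr J Λ)) := Nat.card_pos
    exact_mod_cast this.ne'
  have hG : ∀ g : algGroup F R J, ∑ x : algGroup F R J,
      θ (M (((x : Rˣ) : R) * (((g : Rˣ) : R) - 1) * (((x : Rˣ)⁻¹ : Rˣ) : R))) =
      ∑ x : algGroup F R J, D (x * g * x⁻¹) := by
    intro g
    apply mul_left_cancel₀ hL0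
    have h1 : ∀ x : algGroup F R J, (Nat.card (lone J (rstr J Λ)) : ℂ) * D (x * g * x⁻¹) =
        ∑ z : algGroup F R (lone J (rstr J Λ)), θ (M (((z : Rˣ) : R) * (((x : Rˣ) : R) *
          (((g : Rˣ) : R) - 1) * (((x : Rˣ)⁻¹ : Rˣ) : R)) * (((z : Rˣ)⁻¹ : Rˣ) : R))) := by
      intro x
      have h2 : ((x : Rˣ) : R) * (((g : Rˣ) : R) - 1) * (((x : Rˣ)⁻¹ : Rˣ) : R) =
          (((x * g * x⁻¹ : algGroup F R J) : Rˣ) : R) - 1 := by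
        simp [mul_sub, sub_mul]
      rw [h2, sum_lone_conj hJ hθ hM (x * g * x⁻¹).2.1]
    rw [Finset.mul_sum, Finset.mul_sum, Finset.sum_congr rfl fun x _ => h1 x, Finset.sum_comm,
      ← Finset.mul_sum]
    have h3 : ∀ z : algGroup F R (lone J (rstr J Λ)), ∑ x : algGroup F R J,
        θ (M (((z : Rˣ) : R) * (((x : Rˣ) : R) *
          (((g : Rˣ) : R) - 1) * (((x : Rˣ)⁻¹ : Rˣ) : R)) * (((z : Rˣ)⁻¹ : Rˣ) : R))) =
        ∑ x : algGroup F R J,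
          θ (M (((x : Rˣ) : R) * (((g : Rˣ) : R) - 1) * (((x : Rˣ)⁻¹ : Rˣ) : R))) := by
      intro z
      refine Fintype.sum_equiv (Equiv.mulLeft
        (⟨z, algGroup_mono (lone_le J _) z.2⟩ : algGroup F R J)) _ _ fun x => ?_
      simp [mul_assoc]
    rw [Finset.sum_congr rfl fun z _ => h3 z, Finset.sum_const, Finset.card_univ, nsmul_eq_mul,
      ← Nat.card_eq_fintype_card, card_algGroup (hJ.mono (lone_le J _))]
  have hS : ∀ g, indHom ι (kirillov θ (sone J (rstr J Λ)) (rstr _ M)) g =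
      d * ∑ x : algGroup F R J, D (x * g * x⁻¹) := by
    intro g
    have h1 : ∀ s : algGroup F R (sone J (rstr J Λ)), (∑ x : algGroup F R J,
        ∑ h : algGroup F R (sone J (rstr J Λ)), if ι h = x * g * x⁻¹ then
          θ (M (((s : Rˣ) : R) * (((h : Rˣ) : R) - 1) * (((s : Rˣ)⁻¹ : Rˣ) : R))) else 0) =
        ∑ x : algGroup F R J, D (x * g * x⁻¹) := by
      intro s
      refine Fintype.sum_equiv (Equiv.mulLeft (ι s)) _ _ fun x => ?_
      refine Eq.trans ?_ (sum_soneIncl_eq θ M (rstr J Λ) _)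
      refine Fintype.sum_equiv (MulAut.conj s).toEquiv _ _ fun h => ?_
      have h2 : ι (s * h * s⁻¹) = ι s * x * g * (ι s * x)⁻¹ ↔ ι h = x * g * x⁻¹ := by
        rw [map_mul, map_mul, map_inv]
        constructor
        · intro e
          have := congrArg (fun y => (ι s)⁻¹ * y * ι s) e
          simpa [mul_assoc] using this
        · intro e; rw [e]; group
      simp only [MulEquiv.toEquiv_eq_coe, EquivLike.coe_coe, MulAut.conj_apply,
        Equiv.coe_mulLeft, ← hι, h2]
      simp [mul_sub, sub_mul]
    have h0 := card_ne_zero' (G := algGroup F R (sone J (rstr J Λ)))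
    have h4 : ∑ x : algGroup F R J, ∑ h : algGroup F R (sone J (rstr J Λ)),
        (if ι h = x * g * x⁻¹ then kirillov θ (sone J (rstr J Λ)) (rstr _ M) h else 0) =
        d * ∑ s : algGroup F R (sone J (rstr J Λ)), ∑ x : algGroup F R J,
          ∑ h : algGroup F R (sone J (rstr J Λ)), if ι h = x * g * x⁻¹ then
          θ (M (((s : Rˣ) : R) * (((h : Rˣ) : R) - 1) * (((s : Rˣ)⁻¹ : Rˣ) : R))) else 0 := by
      conv_rhs => rw [Finset.sum_comm, Finset.mul_sum]
      refine Finset.sum_congr rfl fun x _ => ?_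
      conv_rhs => rw [Finset.sum_comm, Finset.mul_sum]
      refine Finset.sum_congr rfl fun h _ => ?_
      split_ifs
      · exact hd h
      · simp
    have h5 : indHom ι (kirillov θ (sone J (rstr J Λ)) (rstr _ M)) g =
        (Nat.card (algGroup F R (sone J (rstr J Λ))) : ℂ)⁻¹ * ∑ x : algGroup F R J,
          ∑ h : algGroup F R (sone J (rstr J Λ)), (if ι h = x * g * x⁻¹ then
            kirillov θ (sone J (rstr J Λ)) (rstr _ M) h else 0) := by
      unfold indHom
      congr!
    rw [h5, h4, Finset.sum_congr rfl fun s _ => h1 s, Finset.sum_const, Finset.card_univ,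
      nsmul_eq_mul, ← Nat.card_eq_fintype_card]
    field_simp
  have hmul := fun s z hz => kirillov_mul (θ := θ) hM s z hz
  have hnorm := (isMackeyDatum hθ hJ Λ).innerG_indHom
    (kirillov_isClassFun θ (sone J (rstr J Λ)) (rstr _ M)) hmul hmul
  rw [innerG_kirillov hθ (hJ.mono (sone_le J _))] at hnorm
  have hprop : indHom ι (kirillov θ (sone J (rstr J Λ)) (rstr _ M)) =
      fun g => ((d / c : ℝ) : ℂ) * kirillov θ J (rstr J M) g := by
    funext g
    have : (c : ℂ) ≠ 0 := by exact_mod_cast hc0.ne'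
    rw [hS, hc, hG]
    push_cast
    field_simp
  rw [← hι, hprop, innerG_smul_self, innerG_kirillov hθ hJ, Complex.conj_ofReal, mul_one] at hnorm
  have h1 : (d / c) * (d / c) = 1 := by exact_mod_cast hnorm
  have h2 : d / c = 1 := by
    have : 0 < d / c := div_pos hd0 hc0
    nlinarith
  rw [hprop, h2]
  simp

end Induction

section Transfer

variable {J : NonUnitalSubalgebra F R} {Λ : R →ₗ[F] F}

/-! ### Transfer between `G` and `S_λ/K_λ` -/

theorem exists_kirillov_eq_of_sum_LgrpIn_ne_zero (hJ : IsNil J) {θ : AddChar F ℂ} (hθ : θ ≠ 1)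
    (nu : J →ₗ[F] F)
    (h : ∑ z : LgrpIn J (rstr J Λ), thetaFn θ (sone J (rstr J Λ)) (rstr _ Λ) z *
      (starRingEnd ℂ) (kirillov θ J nu (soneIncl J (rstr J Λ) z)) ≠ 0) :
    ∃ M : R →ₗ[F] F, kirillov θ J (rstr J M) = kirillov θ J nu ∧
      ∀ X ∈ lone J (rstr J Λ), M X = Λ X := by
  refine exists_kirillov_eq_of_sum_ne_zero hθ (hJ.mono (lone_le J _)) (lone_le J (rstr J Λ)) Λ nu ?_
  rw [← sum_LgrpIn]
  exact h

theorem exists_kirillov_sone_eq_of_sum_ne_zero (hJ : IsNil J) {θ : AddChar F ℂ} (hθ : θ ≠ 1)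
    (nu : sone J (rstr J Λ) →ₗ[F] F)
    (h : ∑ z : LgrpIn J (rstr J Λ), thetaFn θ (sone J (rstr J Λ)) (rstr _ Λ) z *
      (starRingEnd ℂ) (kirillov θ (sone J (rstr J Λ)) nu z) ≠ 0) :
    ∃ M : R →ₗ[F] F, kirillov θ (sone J (rstr J Λ)) (rstr _ M) =
      kirillov θ (sone J (rstr J Λ)) nu ∧ ∀ X ∈ lone J (rstr J Λ), M X = Λ X := by
  refine exists_kirillov_eq_of_sum_ne_zero hθ (hJ.mono (lone_le J _)) lone_le_sone Λ nu ?_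
  rw [← sum_LgrpIn]
  exact h

theorem KgrpIn_le_LgrpIn (lam : J →ₗ[F] F) : KgrpIn J lam ≤ LgrpIn J lam := by
  intro z hz
  exact ⟨kone_le J lam hz.1, kone_le J lam hz.2⟩

theorem thetaFn_eq_one_of_mem_KgrpIn (θ : AddChar F ℂ) {z : algGroup F R (sone J (rstr J Λ))}
    (hz : z ∈ KgrpIn J (rstr J Λ)) :
    thetaFn θ (sone J (rstr J Λ)) (rstr _ Λ) z = 1 := by
  have h : Λ (((z : Rˣ) : R) - 1) = 0 := apply_eq_zero_of_mem_kone hz.1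
  rw [thetaFn_rstr, h, AddChar.map_zero_eq_one]

theorem isKirillov_quotient_of_isKirillov (hJ : IsNil J) {θ : AddChar F ℂ} (hθ : θ ≠ 1)
    {ψ : (algGroup F R (sone J (rstr J Λ)) ⧸ KgrpIn J (rstr J Λ)) → ℂ} (hψ : ψ ∈ Irr _)
    (hψL : ∀ z ∈ LgrpIn J (rstr J Λ), ψ (QuotientGroup.mk z) =
      ψ 1 * thetaFn θ (sone J (rstr J Λ)) (rstr _ Λ) z)
    (hpos : 0 < ψ 1)
    (hK : ∀ φ ∈ IrrConstituents (algGroup F R J) (superchar θ J (rstr J Λ)),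
      φ 1 = Nat.card (algGroup F R J) / Nat.card (algGroup F R (sone J (rstr J Λ))) * ψ 1 →
        ∃ mu : J →ₗ[F] F, φ = kirillov θ J mu) :
    ∃ M : R →ₗ[F] F, (∀ X ∈ lone J (rstr J Λ), M X = Λ X) ∧
      ∀ s, ψ (QuotientGroup.mk s) = kirillov θ (sone J (rstr J Λ)) (rstr _ M) s := by
  have D := isMackeyDatum hθ hJ Λ
  set f : algGroup F R (sone J (rstr J Λ)) → ℂ := fun s => ψ (QuotientGroup.mk s) with hf
  have hfchar : IsCharacter _ f := isCharacter_inflate (KgrpIn J (rstr J Λ)) hψ.1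
  have hfI : f ∈ Irr _ := ⟨hfchar, by
    rw [hf, innerG_quotient (KgrpIn J (rstr J Λ)) ψ ψ]; exact hψ.2⟩
  have hf1 : f 1 = ψ 1 := rfl
  have hmul := hfchar.map_mul_of_restrict _ D.stable hψL
  have hsum := D.sum_indHom hfchar.isClassFun hmul
  have hconj : (starRingEnd ℂ) (ψ 1) = ψ 1 :=
    Complex.conj_eq_iff_im.2 (Complex.pos_iff.1 hpos).2.symm
  rw [hf1, hconj] at hsum
  have hcard : (0 : ℂ) < Nat.card (LgrpIn J (rstr J Λ)) := by
    exact_mod_cast Nat.card_pos (α := LgrpIn J (rstr J Λ))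
  obtain ⟨c, hc, hpair⟩ := exists_innerG_superchar hJ hθ Λ
  have hc' : (0 : ℂ) < c := by exact_mod_cast hc
  obtain ⟨nu, hnu⟩ := hK (indHom (soneIncl J (rstr J Λ)) f)
    ⟨D.indHom_mem_Irr hfI hmul, by
      rw [hpair _ (indHom_isClassFun _ _), hsum]
      exact mul_pos hc' (mul_pos hcard hpos)⟩ (indHom_one _ D.injective f)
  have hne := (mul_pos hcard hpos).ne'
  rw [← hsum, hnu] at hne
  obtain ⟨M, hM, hMΛ⟩ := exists_kirillov_eq_of_sum_LgrpIn_ne_zero hJ hθ nu hne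
  refine ⟨M, hMΛ, fun s => congrFun (D.indHom_injective hfchar.isClassFun
    (kirillov_isClassFun θ _ (rstr _ M)) hmul (fun s z hz => kirillov_mul hMΛ s z hz) ?_) s⟩
  rw [hnu, indHom_kirillov hJ hθ hMΛ, hM]

theorem isKirillov_of_isKirillov_quotient (hJ : IsNil J) {θ : AddChar F ℂ} (hθ : θ ≠ 1)
    {φ : algGroup F R J → ℂ}
    (hφ : φ ∈ IrrConstituents (algGroup F R J) (superchar θ J (rstr J Λ)))
    (hφ1 : φ 1 ≠ 0)
    (hK : ∀ ψ ∈ Irr (algGroup F R (sone J (rstr J Λ)) ⧸ KgrpIn J (rstr J Λ)),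
      (∀ z ∈ LgrpIn J (rstr J Λ), ψ (QuotientGroup.mk z) =
        ψ 1 * thetaFn θ (sone J (rstr J Λ)) (rstr _ Λ) z) →
      φ 1 = Nat.card (algGroup F R J) / Nat.card (algGroup F R (sone J (rstr J Λ))) * ψ 1 →
        ∃ mu : sone J (rstr J Λ) →ₗ[F] F,
          ∀ s, ψ (QuotientGroup.mk s) = kirillov θ (sone J (rstr J Λ)) mu s) :
    ∃ mu : J →ₗ[F] F, φ = kirillov θ J mu := by
  have D := isMackeyDatum hθ hJ Λ
  obtain ⟨c, hc, hpair⟩ := exists_innerG_superchar hJ hθ Λ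
  have hne := hφ.2.ne'
  rw [hpair _ hφ.1.1.isClassFun] at hne
  obtain ⟨ψ, hψ, hψL, hind⟩ := D.exists_indHom_eq (KgrpIn J (rstr J Λ)) (KgrpIn_le_LgrpIn _)
    (fun z hz => thetaFn_eq_one_of_mem_KgrpIn θ hz) hφ.1 (right_ne_zero_of_mul hne)
  have h1 := indHom_one _ D.injective
    fun s : algGroup F R (sone J (rstr J Λ)) => ψ (QuotientGroup.mk s)
  rw [hind] at h1
  have hψ1 : ψ 1 ≠ 0 := fun h => hφ1 (by
    rw [h1]; exact mul_eq_zero_of_right _ h)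
  obtain ⟨mu, hmu⟩ := hK ψ hψ hψL h1
  have hmu' : (fun s => ψ (QuotientGroup.mk s)) = kirillov θ (sone J (rstr J Λ)) mu := funext hmu
  have hsum : ∑ z : LgrpIn J (rstr J Λ), thetaFn θ (sone J (rstr J Λ)) (rstr _ Λ) z *
      (starRingEnd ℂ) (kirillov θ (sone J (rstr J Λ)) mu z) =
      Nat.card (LgrpIn J (rstr J Λ)) * (starRingEnd ℂ) (ψ 1) := by
    have : ∀ z : LgrpIn J (rstr J Λ), thetaFn θ (sone J (rstr J Λ)) (rstr _ Λ) z *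
      (starRingEnd ℂ) (kirillov θ (sone J (rstr J Λ)) mu z) = (starRingEnd ℂ) (ψ 1) := by
      intro z
      rw [← hmu, hψL _ z.2, map_mul, D.stable.map_conj _ z.2, mul_left_comm,
        ← D.stable.map_mul _ z.2 _ (inv_mem z.2), mul_inv_cancel, D.stable.map_one, mul_one]
    rw [Finset.sum_congr rfl fun z _ => this z, Finset.sum_const, Finset.card_univ, nsmul_eq_mul,
      Nat.card_eq_fintype_card]
  obtain ⟨M, hM, hMΛ⟩ := exists_kirillov_sone_eq_of_sum_ne_zero hJ hθ mu (by
    rw [hsum]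
    exact mul_ne_zero (card_ne_zero' (G := LgrpIn J (rstr J Λ)))
      ((map_ne_zero (starRingEnd ℂ)).2 hψ1))
  exact ⟨rstr J M, by rw [← indHom_kirillov hJ hθ hMΛ, hM, ← hmu', hind]⟩

end Transfer

theorem statement14 (F : Type) [Field F] [Fintype F]
    (R : Type) [Ring R] [Algebra F R] [Fintype R]
    (J : NonUnitalSubalgebra F R) (hJ : IsNil J)
    (θ : AddChar F ℂ) (hθ : θ ≠ 1)
    (lam : ↥J →ₗ[F] F) (e : ℕ) :
    (∀ ψ ∈ IrrConstituents ↥(algGroup F R J) (superchar θ J lam),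
        ψ 1 = (Fintype.card F : ℂ) ^ e →
        ∃ mu : ↥J →ₗ[F] F, ψ = kirillov θ J mu) ↔
    (∀ ψ : (↥(algGroup F R (sone J lam)) ⧸ KgrpIn J lam) → ℂ,
        ψ ∈ Irr (↥(algGroup F R (sone J lam)) ⧸ KgrpIn J lam) →
        (∀ (z : Rˣ) (hzS : z ∈ algGroup F R (sone J lam)),
          z ∈ algGroup F R (lone J lam) → ∀ (hzG : z ∈ algGroup F R J),
          ψ (QuotientGroup.mk ⟨z, hzS⟩) =
            ((Nat.card ↥(leftOrbit J lam ∩ rightOrbit J lam) : ℂ) /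
                (Nat.card ↥(leftOrbit J lam) : ℂ)) *
              (Fintype.card F : ℂ) ^ e * thetaFn θ J lam ⟨z, hzG⟩) →
        ∃ mu : ↥(sone J lam) →ₗ[F] F,
          (∀ (x : R), x ∈ kone J lam → ∀ (hxs : x ∈ sone J lam), mu ⟨x, hxs⟩ = 0) ∧
          ∀ s : ↥(algGroup F R (sone J lam)),
            ψ (QuotientGroup.mk s) = kirillov θ (sone J lam) mu s) := by
  obtain ⟨Λ, rfl⟩ := exists_rstr J lam
  rw [card_orbit_ratio hJ Λ]
  have hG' : (0 : ℂ) < Nat.card (algGroup F R J) := by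
    exact_mod_cast Nat.card_pos (α := algGroup F R J)
  have hS' : (0 : ℂ) < Nat.card (algGroup F R (sone J (rstr J Λ))) := by
    exact_mod_cast Nat.card_pos (α := algGroup F R (sone J (rstr J Λ)))
  have hq : (0 : ℂ) < (Fintype.card F : ℂ) ^ e := pow_pos (by exact_mod_cast Fintype.card_pos) e
  constructor
  · intro hK ψ hψ hψL
    have hψ1 := hψL 1 (one_mem _) (one_mem _) (one_mem _)
    rw [thetaFn_rstr, Units.val_one, sub_self, map_zero, AddChar.map_zero_eq_one, mul_one] at hψ1
    replace hψ1 : ψ 1 = _ := hψ1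
    obtain ⟨M, hM, hψM⟩ := isKirillov_quotient_of_isKirillov hJ hθ hψ
      (fun z hz => by
        rw [hψ1]
        exact hψL z z.2 hz (algGroup_mono (sone_le J _) z.2))
      (by rw [hψ1]; exact mul_pos (div_pos hS' hG') hq)
      (fun φ hφ hφ1 => hK φ hφ (by rw [hφ1, hψ1]; field_simp))
    refine ⟨rstr _ M, fun x hx hxs => ?_, hψM⟩
    rw [rstr_apply, hM x (kone_le J _ hx)]
    exact apply_eq_zero_of_mem_kone hx
  · intro hK φ hφ hφ1
    refine isKirillov_of_isKirillov_quotient hJ hθ hφ (by rw [hφ1]; exact hq.ne')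
      fun ψ hψ hψL hψ1 => ?_
    obtain ⟨mu, -, hmu⟩ := hK ψ hψ fun z hzS hzL hzG => by
      refine (hψL ⟨z, hzS⟩ hzL).trans ?_
      rw [hφ1] at hψ1
      rw [hψ1]
      field_simp
      rfl
    exact ⟨mu, hmu⟩

end IterChar
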